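/- arXiv:1810.04818 — 6 statements merged into one kernel-verified Lean document; each statement's English description precedes it below -/
import Mathlib

section
/- Let Ω be a bounded Lipschitz domain in ℝ^N (N ≥ 2), s ∈ (0,1), and p a continuous symmetric function on ℝ^N×ℝ^N with 1 < inf p ≤ sup p < N/s satisfying the log-Hölder type condition (LH). Assume f satisfies the growth condition (F1) with exponent q. Then every weak solution u ∈ W₀^{s,p(·,·)}(Ω) of (−Δ)^s_{p(x)} u = f(x,u) in Ω, u = 0 on ℝ^N∖Ω, belongs to L^∞(Ω), and there exist constants C, τ₁, τ₂ > 0 independent of u such that ‖u‖_{L^∞(Ω)} ≤ C·max{‖u‖^{τ₁}_{L^{q̃(·)}(Ω)}, ‖u‖^{τ₂}_{L^{q̃(·)}(Ω)}}, where q̃(x) := max{p(x,x), q(x)}. -/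
open MeasureTheory Metric Set Filter
open scoped ENNReal NNReal

noncomputable section

/-- `Ω` is a (bounded or unbounded) Lipschitz domain in `ℝ^N`: it is open, nonempty, and near
every boundary point, after a rigid motion (an isometry of `ℝ^N`), `Ω` coincides with the strict
epigraph of a Lipschitz function of the first `N-1` coordinates. -/
def IsLipschitzDomain {N : ℕ} (Ω : Set (EuclideanSpace ℝ (Fin N))) : Prop :=
  IsOpen Ω ∧ Ω.Nonempty ∧
    ∀ z ∈ frontier Ω, ∃ r : ℝ, 0 < r ∧
      ∃ e : EuclideanSpace ℝ (Fin N) ≃ᵢ EuclideanSpace ℝ (Fin N),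
        ∃ L : NNReal, ∃ φ : EuclideanSpace ℝ (Fin N) → ℝ, LipschitzWith L φ ∧
          (∀ x y : EuclideanSpace ℝ (Fin N),
            (∀ i : Fin N, (i : ℕ) + 1 < N → x i = y i) → φ x = φ y) ∧
          ∀ hN : 0 < N, ∀ x ∈ Metric.ball z r,
            (x ∈ Ω ↔ φ (e x) < (e x) ⟨N - 1, Nat.sub_lt hN Nat.one_pos⟩)

/-- The modular `∫_Ω |u(x)|^{q(x)} dx` of the variable exponent Lebesgue space `L^{q(·)}(Ω)`. -/
def modLq {N : ℕ} (Ω : Set (EuclideanSpace ℝ (Fin N))) (q : EuclideanSpace ℝ (Fin N) → ℝ)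
    (u : EuclideanSpace ℝ (Fin N) → ℝ) : ℝ≥0∞ :=
  ∫⁻ x in Ω, ENNReal.ofReal (|u x| ^ q x)

/-- The Luxemburg norm `‖u‖_{L^{q(·)}(Ω)} = inf {λ > 0 : ∫_Ω |u(x)/λ|^{q(x)} dx ≤ 1}`. -/
def luxNorm {N : ℕ} (Ω : Set (EuclideanSpace ℝ (Fin N))) (q : EuclideanSpace ℝ (Fin N) → ℝ)
    (u : EuclideanSpace ℝ (Fin N) → ℝ) : ℝ :=
  sInf {l : ℝ | 0 < l ∧ modLq Ω q (fun x => u x / l) ≤ 1}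

/-- The Gagliardo modular
`∫_Ω ∫_Ω |u(x)-u(y)|^{p(x,y)} / |x-y|^{N+s·p(x,y)} dx dy` with variable exponent `p`. -/
def gagMod {N : ℕ} (Ω : Set (EuclideanSpace ℝ (Fin N))) (s : ℝ)
    (p : EuclideanSpace ℝ (Fin N) → EuclideanSpace ℝ (Fin N) → ℝ)
    (u : EuclideanSpace ℝ (Fin N) → ℝ) : ℝ≥0∞ :=
  ∫⁻ x in Ω, ∫⁻ y in Ω,
    ENNReal.ofReal (|u x - u y| ^ p x y / ‖x - y‖ ^ ((N : ℝ) + s * p x y))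

/-- The Gagliardo seminorm
`[u]_{s,p(·,·),Ω} = inf {λ > 0 : ∫_Ω ∫_Ω |u(x)-u(y)|^{p(x,y)}/(λ^{p(x,y)}|x-y|^{N+s p(x,y)}) < 1}`. -/
def gagSeminorm {N : ℕ} (Ω : Set (EuclideanSpace ℝ (Fin N))) (s : ℝ)
    (p : EuclideanSpace ℝ (Fin N) → EuclideanSpace ℝ (Fin N) → ℝ)
    (u : EuclideanSpace ℝ (Fin N) → ℝ) : ℝ :=
  sInf {l : ℝ | 0 < l ∧ gagMod Ω s p (fun x => u x / l) < 1}

/-- The norm `‖u‖_{s,q,p,Ω} = ‖u‖_{L^{q(·)}(Ω)} + [u]_{s,p(·,·),Ω}` of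
`W^{s,q(·),p(·,·)}(Ω)`. -/
def sobNorm {N : ℕ} (Ω : Set (EuclideanSpace ℝ (Fin N))) (q : EuclideanSpace ℝ (Fin N) → ℝ)
    (s : ℝ) (p : EuclideanSpace ℝ (Fin N) → EuclideanSpace ℝ (Fin N) → ℝ)
    (u : EuclideanSpace ℝ (Fin N) → ℝ) : ℝ :=
  luxNorm Ω q u + gagSeminorm Ω s p u

/-- Membership in `W^{s,q(·),p(·,·)}(Ω)`: `u` is measurable, lies in `L^{q(·)}(Ω)`, and its
Gagliardo modular is finite. -/
def memW {N : ℕ} (Ω : Set (EuclideanSpace ℝ (Fin N))) (q : EuclideanSpace ℝ (Fin N) → ℝ)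
    (s : ℝ) (p : EuclideanSpace ℝ (Fin N) → EuclideanSpace ℝ (Fin N) → ℝ)
    (u : EuclideanSpace ℝ (Fin N) → ℝ) : Prop :=
  Measurable u ∧ modLq Ω q u < ⊤ ∧ gagMod Ω s p u < ⊤

/-- The log-Hölder type condition (LH) on the exponent `p` on `ℝ^N × ℝ^N`:
`inf_{ε>0} sup { |p(x,y) − inf_{B_ε((x,y))} p| · log(1/|x−y|) : 0 < |x−y| < 1/2 } < ∞`,
i.e. for some radius `ε > 0` the displayed supremum is bounded by some constant `C`. -/
def LHCondition {N : ℕ} (p : EuclideanSpace ℝ (Fin N) → EuclideanSpace ℝ (Fin N) → ℝ) : Prop :=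
  ∃ C : ℝ, ∃ ε : ℝ, 0 < ε ∧ ∀ x y : EuclideanSpace ℝ (Fin N),
    0 < ‖x - y‖ → ‖x - y‖ < 1 / 2 →
      |p x y - sInf ((fun z : EuclideanSpace ℝ (Fin N) × EuclideanSpace ℝ (Fin N) => p z.1 z.2) ''
          Metric.ball ((x, y) : EuclideanSpace ℝ (Fin N) × EuclideanSpace ℝ (Fin N)) ε)| *
        Real.log (1 / ‖x - y‖) ≤ C

/-- Membership in `W₀^{s,p(·,·)}(Ω)`: `u ∈ W^{s,p(·,·)}(ℝ^N)` (measurable, `L^{p(·)}(ℝ^N)`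
modular and full-space Gagliardo modular finite) and `u = 0` on `ℝ^N ∖ Ω`. -/
def memW0 {N : ℕ} (Ω : Set (EuclideanSpace ℝ (Fin N))) (s : ℝ)
    (p : EuclideanSpace ℝ (Fin N) → EuclideanSpace ℝ (Fin N) → ℝ)
    (u : EuclideanSpace ℝ (Fin N) → ℝ) : Prop :=
  Measurable u ∧ modLq Set.univ (fun x => p x x) u < ⊤ ∧ gagMod Set.univ s p u < ⊤ ∧
    ∀ x, x ∉ Ω → u x = 0

/-- `u` is a weak solution of `(−Δ)^s_{p(x)} u = f(x,u)` in `Ω`, `u = 0` on `ℝ^N ∖ Ω`: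
`u ∈ W₀^{s,p(·,·)}(Ω)` and the weak formulation holds against every `v ∈ W₀^{s,p(·,·)}(Ω)`. -/
def IsWeakSolution {N : ℕ} (Ω : Set (EuclideanSpace ℝ (Fin N))) (s : ℝ)
    (p : EuclideanSpace ℝ (Fin N) → EuclideanSpace ℝ (Fin N) → ℝ)
    (f : EuclideanSpace ℝ (Fin N) → ℝ → ℝ)
    (u : EuclideanSpace ℝ (Fin N) → ℝ) : Prop :=
  memW0 Ω s p u ∧ ∀ v : EuclideanSpace ℝ (Fin N) → ℝ, memW0 Ω s p v →
    (∫ x : EuclideanSpace ℝ (Fin N), ∫ y : EuclideanSpace ℝ (Fin N),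
        |u x - u y| ^ (p x y - 2) * (u x - u y) * (v x - v y) /
          ‖x - y‖ ^ ((N : ℝ) + s * p x y))
      = ∫ x in Ω, f x (u x) * v x

open scoped Topology

/-- Half the volume of a ball of radius `1 / 2` in `ℝ^N`. -/
def densityConst (N : ℕ) : ℝ :=
  (volume (ball (0 : EuclideanSpace ℝ (Fin N)) 1)).toReal / 2 ^ (N + 1)

lemma densityConst_pos (N : ℕ) : 0 < densityConst N := by
  unfold densityConst
  have h1 : 0 < (volume (ball (0 : EuclideanSpace ℝ (Fin N)) 1)).toReal :=
    ENNReal.toReal_pos (measure_ball_pos _ _ one_pos).ne' measure_ball_lt_top.ne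
  positivity

lemma le_volume_ball_inter_ball {N : ℕ} {z x : EuclideanSpace ℝ (Fin N)} {R r : ℝ}
    (hx : x ∈ ball z R) (hr : 0 < r) (hrR : r ≤ R) :
    ENNReal.ofReal (2 * densityConst N * r ^ N) ≤ volume (ball z R ∩ ball x r) := by
  have hR : 0 < R := hr.trans_le hrR
  have hxz : ‖z - x‖ < R := by rw [← dist_eq_norm, dist_comm]; exact hx
  set c := x + (r / (2 * R)) • (z - x) with hc
  have hτ : 0 ≤ r / (2 * R) := by positivity
  have hτ1 : r / (2 * R) ≤ 1 := by rw [div_le_one (by positivity)]; linarith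
  have hτR : r / (2 * R) * R = r / 2 := by field_simp
  have h1 : dist c x ≤ r / 2 := by
    rw [dist_eq_norm, hc, add_sub_cancel_left, norm_smul, Real.norm_of_nonneg hτ, ← hτR]
    gcongr
  have h2 : dist c z ≤ R - r / 2 := by
    have : c - z = (1 - r / (2 * R)) • (x - z) := by rw [hc]; module
    rw [dist_eq_norm, this, norm_smul, Real.norm_of_nonneg (by linarith), norm_sub_rev, ← hτR]
    have := mul_le_mul_of_nonneg_left hxz.le (sub_nonneg.2 hτ1)
    linarith
  have hsub : ball c (r / 2) ⊆ ball z R ∩ ball x r :=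
    subset_inter (ball_subset_ball' (by linarith)) (ball_subset_ball' (by linarith))
  refine le_trans (le_of_eq ?_) (measure_mono hsub)
  rw [Measure.addHaar_ball_of_pos _ _ (by positivity), finrank_euclideanSpace_fin,
    ← ENNReal.ofReal_toReal (measure_ball_lt_top (μ := volume)
      (x := (0 : EuclideanSpace ℝ (Fin N))) (r := 1)).ne, ← ENNReal.ofReal_mul (by positivity)]
  congr 1
  unfold densityConst
  rw [div_pow, pow_succ]
  field_simp

lemma gagMod_mono {N : ℕ} {A B : Set (EuclideanSpace ℝ (Fin N))} (hAB : A ⊆ B) (s : ℝ)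
    {p : EuclideanSpace ℝ (Fin N) → EuclideanSpace ℝ (Fin N) → ℝ} (hp : ∀ x y, 0 ≤ p x y)
    {u v : EuclideanSpace ℝ (Fin N) → ℝ} (h : ∀ x y, |u x - u y| ≤ |v x - v y|) :
    gagMod A s p u ≤ gagMod B s p v := by
  unfold gagMod
  refine lintegral_mono' (Measure.restrict_mono hAB le_rfl) fun x => ?_
  refine lintegral_mono' (Measure.restrict_mono hAB le_rfl) fun y => ?_
  apply ENNReal.ofReal_le_ofReal
  have := hp x y
  have := h x y
  gcongr

lemma abs_max_sub_le (a b k : ℝ) : |max (a - k) 0 - max (b - k) 0| ≤ |a - b| := by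
  simpa using abs_max_sub_max_le_abs (a - k) (b - k) 0

lemma abs_max_sub_le_of_le {k l : ℝ} (hkl : k ≤ l) (a b : ℝ) :
    |max (a - l) 0 - max (b - l) 0| ≤ |max (a - k) 0 - max (b - k) 0| := by
  have key : ∀ t, max (t - l) 0 = max (max (t - k) 0 - (l - k)) 0 := by
    intro t
    rcases max_cases (t - k) 0 with h | h <;> rw [h.1]
    · ring_nf
    · rw [max_eq_right (by linarith), max_eq_right (by linarith)]
  rw [key a, key b]
  exact abs_max_sub_le _ _ _

/-- A Faber–Krahn type estimate for consecutive superlevel sets. -/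
lemma volume_superlevel_mul_le {N : ℕ} {z : EuclideanSpace ℝ (Fin N)} {R r s P k h D : ℝ}
    {p : EuclideanSpace ℝ (Fin N) → EuclideanSpace ℝ (Fin N) → ℝ}
    {u : EuclideanSpace ℝ (Fin N) → ℝ} (hs : 0 < s) (hP : 0 < P) (hh : 0 < h) (hr : 0 < r)
    (hrR : r ≤ R) (hD : 0 ≤ D) (hu : Measurable u)
    (hp : ∀ x ∈ ball z R, ∀ y ∈ ball z R, P ≤ p x y)
    (hA : volume (ball z R ∩ {x | k < u x}) ≤ ENNReal.ofReal (densityConst N * r ^ N))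
    (hE : gagMod (ball z R) s p (fun x => max (u x - k) 0) ≤ ENNReal.ofReal D) :
    (volume (ball z R ∩ {x | k + h < u x})).toReal *
      (densityConst N * ((h / r ^ s) ^ P - 1)) ≤ D := by
  have hc := densityConst_pos N
  rcases le_total ((h / r ^ s) ^ P - 1) 0 with hm | hm
  · exact (mul_nonpos_of_nonneg_of_nonpos ENNReal.toReal_nonneg
      (mul_nonpos_of_nonneg_of_nonpos hc.le hm)).trans hD
  set m := (h / r ^ s) ^ P - 1 with hm_def
  have hmA : MeasurableSet {x | k < u x} := measurableSet_lt measurable_const hu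
  have hmA' : MeasurableSet (ball z R ∩ {x | k + h < u x}) :=
    measurableSet_ball.inter (measurableSet_lt measurable_const hu)
  have inner : ∀ x ∈ ball z R ∩ {x | k + h < u x}, ENNReal.ofReal (densityConst N * m) ≤
      ∫⁻ y in ball z R, ENNReal.ofReal (|max (u x - k) 0 - max (u y - k) 0| ^ p x y /
        ‖x - y‖ ^ ((N : ℝ) + s * p x y)) := by
    rintro x ⟨hxB, hxu⟩
    simp only [mem_ofPred_eq] at hxu
    set S := (ball z R ∩ ball x r) \ (ball z R ∩ {x | k < u x}) with hS
    have hSvol : ENNReal.ofReal (densityConst N * r ^ N) ≤ volume S := by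
      refine le_trans ?_ (le_measure_sdiff)
      have := tsub_le_tsub (le_volume_ball_inter_ball hxB hr hrR) hA
      refine le_trans (le_of_eq ?_) this
      rw [← ENNReal.ofReal_sub _ (by positivity)]
      congr 1; ring
    have hSm : MeasurableSet S :=
      (measurableSet_ball.inter measurableSet_ball).diff (measurableSet_ball.inter hmA)
    calc ENNReal.ofReal (densityConst N * m)
        = ENNReal.ofReal (m / r ^ N) * ENNReal.ofReal (densityConst N * r ^ N) := by
          rw [← ENNReal.ofReal_mul (by positivity)]
          congr 1; field_simp
      _ ≤ ENNReal.ofReal (m / r ^ N) * volume S := by gcongr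
      _ = ∫⁻ y in S, ENNReal.ofReal (m / r ^ N) := by rw [setLIntegral_const]
      _ ≤ ∫⁻ y in S, ENNReal.ofReal (|max (u x - k) 0 - max (u y - k) 0| ^ p x y /
            ‖x - y‖ ^ ((N : ℝ) + s * p x y)) := by
          refine setLIntegral_mono' hSm fun y hy => ENNReal.ofReal_le_ofReal ?_
          obtain ⟨⟨hyB, hyr⟩, hyA⟩ := hy
          have hyu : u y ≤ k := by
            by_contra hcon
            exact hyA ⟨hyB, not_le.1 hcon⟩
          have hxy : x ≠ y := by rintro rfl; linarith
          have hn : 0 < ‖x - y‖ := norm_pos_iff.2 (sub_ne_zero.2 hxy)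
          have hnr : ‖x - y‖ ≤ r := by
            rw [← dist_eq_norm, dist_comm]; exact (mem_ball.1 hyr).le
          have hPp := hp x hxB y hyB
          have hp0 : 0 ≤ p x y := hP.le.trans hPp
          rw [max_eq_right (by linarith : u y - k ≤ 0), max_eq_left (by linarith), sub_zero,
            abs_of_pos (by linarith)]
          have e1 : h ^ p x y / r ^ ((N : ℝ) + s * p x y) = (h / r ^ s) ^ p x y / r ^ N := by
            rw [Real.rpow_add hr, Real.rpow_natCast, Real.div_rpow hh.le (by positivity),
              ← Real.rpow_mul hr.le]
            field_simp
          calc m / r ^ N ≤ (h / r ^ s) ^ p x y / r ^ N := by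
                gcongr
                rw [hm_def]
                have hq0 : 0 ≤ h / r ^ s := by positivity
                rcases le_total 1 (h / r ^ s) with h1 | h1
                · linarith [Real.rpow_le_rpow_of_exponent_le h1 hPp]
                · linarith [Real.rpow_le_one hq0 h1 hP.le, Real.rpow_nonneg hq0 (p x y)]
            _ = h ^ p x y / r ^ ((N : ℝ) + s * p x y) := e1.symm
            _ ≤ _ := by
                have : h ≤ u x - k := by linarith
                have : 0 ≤ u x - k := by linarith
                gcongr
      _ ≤ _ := lintegral_mono_set (sdiff_subset.trans inter_subset_left)
  have : volume (ball z R ∩ {x | k + h < u x}) * ENNReal.ofReal (densityConst N * m) ≤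
      ENNReal.ofReal D := by
    calc _ = ∫⁻ x in ball z R ∩ {x | k + h < u x}, ENNReal.ofReal (densityConst N * m) := by
          rw [setLIntegral_const, mul_comm]
      _ ≤ _ := setLIntegral_mono' hmA' inner
      _ ≤ gagMod (ball z R) s p (fun x => max (u x - k) 0) :=
          lintegral_mono_set inter_subset_left
      _ ≤ _ := hE
  have h3 := ENNReal.toReal_mono ENNReal.ofReal_ne_top this
  rwa [ENNReal.toReal_mul, ENNReal.toReal_ofReal (by positivity), ENNReal.toReal_ofReal hD] at h3

/-- If `a` decays from level to level with a sublinear power, it has weak-type decay. -/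
lemma le_rpow_of_level_decay {a : ℝ → ℝ} {P θ C : ℝ} (hP : 0 < P) (hθ0 : 0 < θ) (hθ1 : θ < 1)
    (hC : 0 ≤ C) (ha0 : ∀ t, 0 ≤ a t) (ha : Antitone a)
    (h : ∀ t τ, 0 ≤ t → 0 < τ → a (t + τ) * τ ^ P ≤ C * a t ^ θ) {t : ℝ} (ht : 0 < t) :
    a t ≤ (C * 2 ^ (P / (1 - θ))) ^ (1 / (1 - θ)) * t ^ (-(P / (1 - θ))) := by
  have h1θ : 0 < 1 - θ := by linarith
  set σ := P / (1 - θ) with hσ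
  have hσ0 : 0 < σ := by positivity
  have hσθ : σ * θ + P = σ := by rw [hσ]; field_simp; ring
  set g : ℝ → ℝ := fun t => a t * t ^ σ with hg
  have hstep : ∀ τ, 0 < τ → g τ ≤ C * 2 ^ σ * g (τ / 2) ^ θ := by
    intro τ hτ
    have h2 := h (τ / 2) (τ / 2) (by positivity) (by positivity)
    rw [add_halves] at h2
    have hτ2 : 0 < τ / 2 := by positivity
    have e1 : g τ = 2 ^ σ * (a τ * (τ / 2) ^ P) * (τ / 2) ^ (σ * θ) := by
      have : τ ^ σ = 2 ^ σ * ((τ / 2) ^ P * (τ / 2) ^ (σ * θ)) := by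
        rw [← Real.rpow_add hτ2, add_comm P, hσθ, ← Real.mul_rpow (by norm_num) hτ2.le]
        congr 1; ring
      simp only [hg]; rw [this]; ring
    have e2 : g (τ / 2) ^ θ = a (τ / 2) ^ θ * (τ / 2) ^ (σ * θ) := by
      simp only [hg]; rw [Real.mul_rpow (ha0 _) (by positivity), ← Real.rpow_mul hτ2.le]
    rw [e1, e2]
    calc _ ≤ 2 ^ σ * (C * a (τ / 2) ^ θ) * (τ / 2) ^ (σ * θ) := by gcongr
      _ = _ := by ring
  have hg0 : ∀ τ, 0 < τ → 0 ≤ g τ := fun τ hτ => mul_nonneg (ha0 _) (by positivity)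
  set S := sSup (g '' Ioc 0 t)
  have hbdd : BddAbove (g '' Ioc 0 t) := by
    refine ⟨a 0 * t ^ σ, ?_⟩
    rintro _ ⟨τ, ⟨h0, h1⟩, rfl⟩
    exact mul_le_mul (ha h0.le) (Real.rpow_le_rpow h0.le h1 hσ0.le) (by positivity) (ha0 _)
  have hgS : ∀ τ, 0 < τ → τ ≤ t → g τ ≤ S := fun τ h0 h1 =>
    le_csSup hbdd ⟨τ, ⟨h0, h1⟩, rfl⟩
  have hS0 : 0 ≤ S := (hg0 t ht).trans (hgS t ht le_rfl)
  have hSle : S ≤ C * 2 ^ σ * S ^ θ := by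
    refine csSup_le ⟨g t, t, ⟨ht, le_rfl⟩, rfl⟩ ?_
    rintro _ ⟨τ, ⟨h0, h1⟩, rfl⟩
    refine (hstep τ h0).trans ?_
    have := hgS (τ / 2) (by positivity) (by linarith)
    have := hg0 (τ / 2) (by positivity)
    gcongr
  have hSfin : S ≤ (C * 2 ^ σ) ^ (1 / (1 - θ)) := by
    rcases hS0.eq_or_lt with h0 | h0
    · rw [← h0]; positivity
    · have h3 : S ^ (1 - θ) ≤ C * 2 ^ σ := by
        rw [Real.rpow_sub h0, Real.rpow_one, div_le_iff₀ (by positivity)]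
        exact hSle
      calc S = (S ^ (1 - θ)) ^ (1 / (1 - θ)) := by
            rw [← Real.rpow_mul hS0, mul_one_div_cancel h1θ.ne', Real.rpow_one]
        _ ≤ _ := by gcongr
  have h5 := (hgS t ht le_rfl).trans hSfin
  simp only [hg] at h5
  rw [Real.rpow_neg ht.le, ← div_eq_mul_inv, le_div_iff₀ (by positivity)]
  exact h5

/-- Strong-type bound from a weak-type bound, by dyadic decomposition. -/
lemma lintegral_rpow_superlevel_le {α : Type*} [MeasurableSpace α] (μ : Measure α)
    {w : α → ℝ} (hw : Measurable w) {σ Q : ℝ} (hQ : 0 < Q) (hQσ : Q < σ) {W h : ℝ}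
    (hW : 0 ≤ W) (hh : 0 < h)
    (hweak : ∀ t, 0 < t → μ {x | t < w x} ≤ ENNReal.ofReal (W * t ^ (-σ))) :
    ∫⁻ x in {x | h < w x}, ENNReal.ofReal (w x ^ Q) ∂μ ≤
      ENNReal.ofReal (2 ^ Q / (1 - 2 ^ (Q - σ)) * h ^ (-(σ - Q)) * W) := by
  have hm : ∀ t : ℝ, MeasurableSet {x | t < w x} := fun t =>
    measurableSet_lt measurable_const hw
  have hpt : ∀ x ∈ {x | h < w x}, ENNReal.ofReal (w x ^ Q) ≤
      ∑' j : ℕ, {x | 2 ^ j * h < w x}.indicator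
        (fun _ => ENNReal.ofReal ((2 ^ (j + 1) * h) ^ Q)) x := by
    intro x hx
    simp only [mem_ofPred_eq] at hx
    have hex : ∃ n : ℕ, w x ≤ 2 ^ n * h := by
      obtain ⟨n, hn⟩ := pow_unbounded_of_one_lt (w x / h) (one_lt_two)
      exact ⟨n, by rw [div_lt_iff₀ hh] at hn; exact hn.le⟩
    classical
    set n := Nat.find hex with hn
    have hn0 : n ≠ 0 := by
      intro h0
      have := Nat.find_spec hex
      rw [← hn, h0] at this
      simp at this
      linarith
    obtain ⟨j, hj⟩ := Nat.exists_eq_succ_of_ne_zero hn0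
    have h1 : w x ≤ 2 ^ (j + 1) * h := by
      have := Nat.find_spec hex
      rwa [← hn, hj] at this
    have h2 : 2 ^ j * h < w x := by
      have := Nat.find_min hex (m := j) (by rw [← hn, hj]; exact Nat.lt_succ_self j)
      exact not_le.1 this
    refine le_trans ?_ (ENNReal.le_tsum j)
    rw [indicator_of_mem (by exact h2)]
    apply ENNReal.ofReal_le_ofReal
    have : 0 ≤ w x := by linarith
    gcongr
  have hρ0 : (0 : ℝ) < 2 ^ (Q - σ) := by positivity
  have hρ1 : (2 : ℝ) ^ (Q - σ) < 1 := Real.rpow_lt_one_of_one_lt_of_neg (by norm_num) (by linarith)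
  calc ∫⁻ x in {x | h < w x}, ENNReal.ofReal (w x ^ Q) ∂μ
      ≤ ∫⁻ x in {x | h < w x}, ∑' j : ℕ, {x | 2 ^ j * h < w x}.indicator
        (fun _ => ENNReal.ofReal ((2 ^ (j + 1) * h) ^ Q)) x ∂μ := setLIntegral_mono' (hm h) hpt
    _ ≤ ∫⁻ x, ∑' j : ℕ, {x | 2 ^ j * h < w x}.indicator
        (fun _ => ENNReal.ofReal ((2 ^ (j + 1) * h) ^ Q)) x ∂μ := setLIntegral_le_lintegral _ _
    _ = ∑' j : ℕ, ENNReal.ofReal ((2 ^ (j + 1) * h) ^ Q) * μ {x | 2 ^ j * h < w x} := by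
        rw [lintegral_tsum fun j => (measurable_const.indicator (hm _)).aemeasurable]
        congr 1; ext j
        rw [lintegral_indicator (hm _), setLIntegral_const]
    _ ≤ ∑' j : ℕ, ENNReal.ofReal (2 ^ Q * h ^ (-(σ - Q)) * W * (2 ^ (Q - σ)) ^ j) := by
        refine ENNReal.tsum_le_tsum fun j => ?_
        refine (mul_le_mul_right (hweak _ (by positivity)) _).trans (le_of_eq ?_)
        rw [← ENNReal.ofReal_mul (by positivity)]
        congr 1
        have e1 : ((2 : ℝ) ^ (j + 1) * h) ^ Q = 2 ^ Q * (2 ^ j * h) ^ Q := by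
          rw [← Real.mul_rpow (by norm_num) (by positivity)]; ring_nf
        have e2 : ((2 : ℝ) ^ j * h) ^ Q * (2 ^ j * h) ^ (-σ) =
            (2 ^ (Q - σ)) ^ j * h ^ (-(σ - Q)) := by
          rw [← Real.rpow_add (by positivity), Real.mul_rpow (by positivity) hh.le,
            ← Real.rpow_natCast, ← Real.rpow_natCast, ← Real.rpow_mul (by norm_num),
            ← Real.rpow_mul (by norm_num)]
          ring_nf
        calc _ = 2 ^ Q * W * (((2 : ℝ) ^ j * h) ^ Q * (2 ^ j * h) ^ (-σ)) := by rw [e1]; ring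
          _ = _ := by rw [e2]; ring
    _ = ENNReal.ofReal (2 ^ Q / (1 - 2 ^ (Q - σ)) * h ^ (-(σ - Q)) * W) := by
        rw [← ENNReal.ofReal_tsum_of_nonneg (fun j => by positivity)
          ((summable_geometric_of_lt_one hρ0.le hρ1).mul_left _), tsum_mul_left,
          tsum_geometric_of_lt_one hρ0.le hρ1]
        congr 1
        field_simp

/-- Local gain of integrability on superlevel sets, controlled by the Gagliardo energy of the
truncation. -/
lemma exists_local_gain {N : ℕ} (hN : 0 < N) {s P Q R : ℝ} (hs : 0 < s) (hP : 0 < P)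
    (hsP : s * P < N) (hQ : 0 < Q) (hQP : Q < N * P / (N - s * P)) (hR : 0 < R) :
    ∃ C : ℝ, 0 < C ∧ ∃ c₀ : ℝ, 0 < c₀ ∧ ∀ (z : EuclideanSpace ℝ (Fin N))
      (p : EuclideanSpace ℝ (Fin N) → EuclideanSpace ℝ (Fin N) → ℝ)
      (u : EuclideanSpace ℝ (Fin N) → ℝ) (k h D : ℝ), (∀ x y, 0 ≤ p x y) →
      (∀ x ∈ ball z R, ∀ y ∈ ball z R, P ≤ p x y) → Measurable u → 0 < h →
      (volume (ball z R ∩ {x | k < u x})).toReal ≤ c₀ →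
      (volume (ball z R ∩ {x | k < u x})).toReal ≤ D →
      gagMod (ball z R) s p (fun x => max (u x - k) 0) ≤ ENNReal.ofReal D →
      ∫⁻ x in ball z R ∩ {x | k + h < u x}, ENNReal.ofReal ((u x - k) ^ Q) ≤
        ENNReal.ofReal (C * h ^ (-(N * P / (N - s * P) - Q)) * D ^ (N / (N - s * P))) := by
  have hc := densityConst_pos N
  set c := densityConst N
  have hN' : (0 : ℝ) < N := by exact_mod_cast hN
  have hNsP : (0 : ℝ) < N - s * P := by linarith
  set θ : ℝ := s * P / N with hθ
  have hθ0 : 0 < θ := by positivity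
  have hθ1 : θ < 1 := by rw [hθ, div_lt_one hN']; exact hsP
  have hθ' : 0 < 1 - θ := by linarith
  have e1 : 1 / (1 - θ) = N / (N - s * P) := by rw [hθ]; field_simp
  have e2 : P / (1 - θ) = N * P / (N - s * P) := by rw [hθ]; field_simp
  set C₁ : ℝ := (c ^ θ)⁻¹ * (1 / c + 1) with hC₁
  have hC₁0 : 0 < C₁ := by positivity
  rw [← e1, ← e2]
  rw [← e2] at hQP
  have hρ1 : (2 : ℝ) ^ (Q - P / (1 - θ)) < 1 :=
    Real.rpow_lt_one_of_one_lt_of_neg (by norm_num) (by linarith)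
  have hρ2 : 0 < 1 - (2 : ℝ) ^ (Q - P / (1 - θ)) := by linarith
  refine ⟨2 ^ Q / (1 - 2 ^ (Q - P / (1 - θ))) * (C₁ * 2 ^ (P / (1 - θ))) ^ (1 / (1 - θ)),
    by positivity, c * R ^ N, by positivity, ?_⟩
  intro z p u k h D hp0 hp hu hh hAc hAD hE
  have hD : 0 ≤ D := ENNReal.toReal_nonneg.trans hAD
  have hfin : ∀ t, volume (ball z R ∩ {x | k + t < u x}) ≠ ⊤ := fun t =>
    ((measure_mono inter_subset_left).trans_lt measure_ball_lt_top).ne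
  set a : ℝ → ℝ := fun t => (volume (ball z R ∩ {x | k + t < u x})).toReal with ha
  have ha0 : ∀ t, 0 ≤ a t := fun t => ENNReal.toReal_nonneg
  have hanti : Antitone a := by
    intro t t' htt
    refine ENNReal.toReal_mono (hfin t) (measure_mono (inter_subset_inter_right _ ?_))
    intro x (hx : k + t' < u x)
    show k + t < u x
    linarith
  have ha_zero : a 0 = (volume (ball z R ∩ {x | k < u x})).toReal := by simp [ha]
  have hdecay : ∀ t τ, 0 ≤ t → 0 < τ → a (t + τ) * τ ^ P ≤ (C₁ * D) * a t ^ θ := by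
    intro t τ ht hτ
    have hat := hanti ht
    have hmono : a (t + τ) ≤ a t := hanti (by linarith)
    rcases (ha0 t).eq_or_lt with h0 | h0
    · have : a (t + τ) = 0 := le_antisymm (by linarith) (ha0 _)
      rw [this, zero_mul]
      positivity
    set r : ℝ := (a t / c) ^ (1 / (N : ℝ)) with hr
    have hr0 : 0 < r := by positivity
    have hrN : r ^ N = a t / c := by
      rw [hr, ← Real.rpow_natCast, ← Real.rpow_mul (by positivity), one_div_mul_cancel hN'.ne',
        Real.rpow_one]
    have hrR : r ≤ R := by
      refine le_of_pow_le_pow_left₀ hN.ne' hR.le ?_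
      rw [hrN, div_le_iff₀ hc]
      linarith
    have hrs : (r ^ s) ^ P = a t ^ θ * (c ^ θ)⁻¹ := by
      rw [hr, ← Real.rpow_mul (by positivity), ← Real.rpow_mul (by positivity),
        show 1 / (N : ℝ) * (s * P) = θ by rw [hθ]; ring, Real.div_rpow h0.le hc.le, div_eq_mul_inv]
    have key := volume_superlevel_mul_le (z := z) (k := k + t) (h := τ) (D := D) hs hP hτ hr0 hrR
      hD hu hp (by
        rw [hrN, mul_div_cancel₀ _ hc.ne', ha, ENNReal.ofReal_toReal (hfin t)]) (by
        refine le_trans (gagMod_mono subset_rfl s hp0 fun x y => ?_) hE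
        exact abs_max_sub_le_of_le (by linarith) _ _)
    have hcast : (volume (ball z R ∩ {x | k + t + τ < u x})).toReal = a (t + τ) := by
      simp only [ha, add_assoc]
    rw [hcast, Real.div_rpow hτ.le (by positivity)] at key
    have hrsP : 0 < (r ^ s) ^ P := by positivity
    have h1 : a (t + τ) * τ ^ P ≤ (r ^ s) ^ P * (D / c + a (t + τ)) := by
      have : a (t + τ) * τ ^ P = (r ^ s) ^ P * (a (t + τ) * (c * (τ ^ P / (r ^ s) ^ P - 1)) / c
          + a (t + τ)) := by field_simp; ring
      rw [this]
      gcongr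
    refine h1.trans ?_
    rw [hrs]
    have : a (t + τ) ≤ D := by linarith
    calc _ ≤ a t ^ θ * (c ^ θ)⁻¹ * (D / c + D) := by gcongr
      _ = _ := by rw [hC₁]; ring
  have hweak := fun t (ht : 0 < t) =>
    le_rpow_of_level_decay hP hθ0 hθ1 (by positivity) ha0 hanti hdecay ht
  have hm : MeasurableSet {x | h < u x - k} := measurableSet_lt measurable_const (hu.sub_const k)
  have hset : ∀ t, {x | t < u x - k} = {x | k + t < u x} := fun t => by
    ext x; simp only [mem_ofPred_eq]; constructor <;> intro _ <;> linarith
  have hfinal := lintegral_rpow_superlevel_le (volume.restrict (ball z R)) (hu.sub_const k) hQ hQP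
    (W := (C₁ * D * 2 ^ (P / (1 - θ))) ^ (1 / (1 - θ))) (by positivity) hh (fun t ht => by
      rw [Measure.restrict_apply (measurableSet_lt measurable_const (hu.sub_const k)), hset,
        inter_comm, ← ENNReal.ofReal_toReal (hfin t)]
      exact ENNReal.ofReal_le_ofReal (hweak t ht))
  rw [Measure.restrict_restrict hm, hset, inter_comm] at hfinal
  refine hfinal.trans (le_of_eq ?_)
  congr 1
  rw [show C₁ * D * 2 ^ (P / (1 - θ)) = C₁ * 2 ^ (P / (1 - θ)) * D by ring,
    Real.mul_rpow (by positivity) hD]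
  ring

lemma rpow_le_rpow_sub_two_mul {a b p : ℝ} (hp : 1 < p) (hba : |b| ≤ |a|) (hab : 0 ≤ a * b) :
    |b| ^ p ≤ |a| ^ (p - 2) * a * b ∧ |a| ^ (p - 2) * a * b ≤ |a| ^ p := by
  rcases eq_or_ne a 0 with rfl | ha
  · have : b = 0 := by simpa using hba
    subst this
    simp [Real.zero_rpow (by linarith : p ≠ 0)]
  have ha0 : 0 < |a| := abs_pos.2 ha
  have e1 : |a| ^ (p - 2) * a * b = |a| ^ (p - 1) * |b| := by
    rw [mul_assoc, ← abs_of_nonneg hab, abs_mul, ← mul_assoc, ← Real.rpow_add_one ha0.ne']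
    ring_nf
  have e2 : ∀ t : ℝ, 0 ≤ t → t ^ p = t ^ (p - 1) * t := fun t ht => by
    rw [← Real.rpow_add_one' ht (by linarith)]; ring_nf
  have hp1 : 0 ≤ p - 1 := by linarith
  rw [e1, e2 _ (abs_nonneg b), e2 _ ha0.le]
  constructor <;> gcongr

lemma mul_max_sub_nonneg (a b k : ℝ) : 0 ≤ (a - b) * (max (a - k) 0 - max (b - k) 0) := by
  rcases le_total a b with h | h
  · exact mul_nonneg_of_nonpos_of_nonpos (by linarith)
      (sub_nonpos.2 (max_le_max (by linarith) le_rfl))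
  · exact mul_nonneg (by linarith) (sub_nonneg.2 (max_le_max (by linarith) le_rfl))

lemma memW0_truncation {N : ℕ} {Ω : Set (EuclideanSpace ℝ (Fin N))} {s k : ℝ}
    {p : EuclideanSpace ℝ (Fin N) → EuclideanSpace ℝ (Fin N) → ℝ}
    {u : EuclideanSpace ℝ (Fin N) → ℝ} (hp : ∀ x y, 0 ≤ p x y) (hk : 0 < k)
    (hu : memW0 Ω s p u) : memW0 Ω s p fun x => max (u x - k) 0 := by
  obtain ⟨hm, hL, hG, h0⟩ := hu
  refine ⟨(hm.sub_const k).max measurable_const, lt_of_le_of_lt ?_ hL,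
    (gagMod_mono subset_rfl s hp fun x y => abs_max_sub_le _ _ k).trans_lt hG, fun x hx => ?_⟩
  · refine lintegral_mono fun x => ENNReal.ofReal_le_ofReal ?_
    refine Real.rpow_le_rpow (abs_nonneg _) ?_ (hp x x)
    rw [abs_of_nonneg (le_max_right _ _)]
    exact max_le (by linarith [le_abs_self (u x)]) (abs_nonneg _)
  · simp [h0 x hx, hk.le]

lemma gagMod_truncation_le {N : ℕ} {Ω : Set (EuclideanSpace ℝ (Fin N))} (hΩ : MeasurableSet Ω)
    {s k C : ℝ} {p : EuclideanSpace ℝ (Fin N) → EuclideanSpace ℝ (Fin N) → ℝ}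
    (hp_cont : Continuous
      (fun z : EuclideanSpace ℝ (Fin N) × EuclideanSpace ℝ (Fin N) => p z.1 z.2))
    (hp : ∀ x y, 1 < p x y) {q : EuclideanSpace ℝ (Fin N) → ℝ} (hq : ∀ x ∈ Ω, 1 ≤ q x)
    {f : EuclideanSpace ℝ (Fin N) → ℝ → ℝ} (hC : 0 < C)
    (hf : ∀ᵐ x ∂(volume.restrict Ω), ∀ t : ℝ, |f x t| ≤ C * (1 + |t| ^ (q x - 1)))
    {u : EuclideanSpace ℝ (Fin N) → ℝ} (hu : IsWeakSolution Ω s p f u) (hk : 0 < k) :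
    gagMod univ s p (fun x => max (u x - k) 0) ≤ ENNReal.ofReal (2 * C) *
      ∫⁻ x in Ω ∩ {x | k < u x}, ENNReal.ofReal (1 + |u x| ^ max (p x x) (q x)) := by
  have hp0 : ∀ x y, 0 ≤ p x y := fun x y => (zero_lt_one.trans (hp x y)).le
  obtain ⟨hu0, hweak⟩ := hu
  have hv0 := memW0_truncation hp0 hk hu0
  have hum := hu0.1
  have hvm := hv0.1
  have heq := hweak _ hv0
  set v : EuclideanSpace ℝ (Fin N) → ℝ := fun x => max (u x - k) 0 with hv
  set G : EuclideanSpace ℝ (Fin N) × EuclideanSpace ℝ (Fin N) → ℝ := fun z =>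
    |u z.1 - u z.2| ^ (p z.1 z.2 - 2) * (u z.1 - u z.2) * (v z.1 - v z.2) /
      ‖z.1 - z.2‖ ^ ((N : ℝ) + s * p z.1 z.2) with hG
  have hpm : Measurable
      (fun z : EuclideanSpace ℝ (Fin N) × EuclideanSpace ℝ (Fin N) => p z.1 z.2) :=
    hp_cont.measurable
  have hdu : Measurable
      (fun z : EuclideanSpace ℝ (Fin N) × EuclideanSpace ℝ (Fin N) => u z.1 - u z.2) :=
    (hum.comp measurable_fst).sub (hum.comp measurable_snd)
  have hdv : Measurable
      (fun z : EuclideanSpace ℝ (Fin N) × EuclideanSpace ℝ (Fin N) => v z.1 - v z.2) :=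
    (hvm.comp measurable_fst).sub (hvm.comp measurable_snd)
  have habs : ∀ {g : EuclideanSpace ℝ (Fin N) × EuclideanSpace ℝ (Fin N) → ℝ}, Measurable g →
      Measurable fun z => |g z| := fun hg => by
    simpa only [Real.norm_eq_abs] using hg.norm
  have hker : Measurable (fun z : EuclideanSpace ℝ (Fin N) × EuclideanSpace ℝ (Fin N) =>
      ‖z.1 - z.2‖ ^ ((N : ℝ) + s * p z.1 z.2)) :=
    (measurable_fst.sub measurable_snd).norm.pow (measurable_const.add (hpm.const_mul s))
  have hGm : Measurable G :=
    ((((habs hdu).pow (hpm.sub_const 2)).mul hdu).mul hdv).div hker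
  have hHm : Measurable (fun z : EuclideanSpace ℝ (Fin N) × EuclideanSpace ℝ (Fin N) =>
      ENNReal.ofReal (|u z.1 - u z.2| ^ p z.1 z.2 / ‖z.1 - z.2‖ ^ ((N : ℝ) + s * p z.1 z.2))) :=
    (((habs hdu).pow hpm).div hker).ennreal_ofReal
  have hpt : ∀ z, |v z.1 - v z.2| ^ p z.1 z.2 / ‖z.1 - z.2‖ ^ ((N : ℝ) + s * p z.1 z.2) ≤ G z ∧
      G z ≤ |u z.1 - u z.2| ^ p z.1 z.2 / ‖z.1 - z.2‖ ^ ((N : ℝ) + s * p z.1 z.2) := by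
    intro z
    have := rpow_le_rpow_sub_two_mul (hp z.1 z.2) (abs_max_sub_le (u z.1) (u z.2) k)
      (mul_max_sub_nonneg (u z.1) (u z.2) k)
    exact ⟨div_le_div_of_nonneg_right this.1 (by positivity),
      div_le_div_of_nonneg_right this.2 (by positivity)⟩
  have hGnn : ∀ z, 0 ≤ G z := fun z => le_trans (by positivity) (hpt z).1
  have hGint : Integrable G (volume.prod volume) := by
    refine ⟨hGm.aestronglyMeasurable, ?_⟩
    rw [hasFiniteIntegral_iff_ofReal (Eventually.of_forall hGnn)]
    calc _ ≤ ∫⁻ z, ENNReal.ofReal (|u z.1 - u z.2| ^ p z.1 z.2 /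
          ‖z.1 - z.2‖ ^ ((N : ℝ) + s * p z.1 z.2)) ∂(volume.prod volume) :=
          lintegral_mono fun z => ENNReal.ofReal_le_ofReal (hpt z).2
      _ = gagMod univ s p u := by
          rw [lintegral_prod _ hHm.aemeasurable]
          simp [gagMod]
      _ < ⊤ := hu0.2.2.1
  have h1 : gagMod univ s p v ≤ ENNReal.ofReal (∫ x in Ω, f x (u x) * v x) := by
    rw [← heq]
    have : ∫ x, ∫ y, |u x - u y| ^ (p x y - 2) * (u x - u y) * (v x - v y) /
        ‖x - y‖ ^ ((N : ℝ) + s * p x y) = ∫ z, G z ∂(volume.prod volume) :=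
      (integral_prod G hGint).symm
    rw [this, ofReal_integral_eq_lintegral_ofReal hGint (Eventually.of_forall hGnn),
      lintegral_prod _ hGm.ennreal_ofReal.aemeasurable]
    simp only [gagMod, Measure.restrict_univ]
    exact lintegral_mono fun x => lintegral_mono fun y =>
      ENNReal.ofReal_le_ofReal (hpt (x, y)).1
  have hmk : MeasurableSet {x | k < u x} := measurableSet_lt measurable_const hum
  refine h1.trans ?_
  calc ENNReal.ofReal (∫ x in Ω, f x (u x) * v x)
      ≤ ‖∫ x in Ω, f x (u x) * v x‖ₑ := by
        rw [← ofReal_norm]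
        exact ENNReal.ofReal_le_ofReal (le_abs_self _)
    _ ≤ ∫⁻ x in Ω, ‖f x (u x) * v x‖ₑ := enorm_integral_le_lintegral_enorm _
    _ ≤ ∫⁻ x in Ω, {x | k < u x}.indicator (fun x => ENNReal.ofReal (2 * C) *
          ENNReal.ofReal (1 + |u x| ^ max (p x x) (q x))) x := by
        refine lintegral_mono_ae ?_
        filter_upwards [hf, ae_restrict_mem hΩ] with x hfx hxΩ
        by_cases hx : k < u x
        · rw [indicator_of_mem (by exact hx), ← ENNReal.ofReal_mul (by positivity), ← ofReal_norm,
            Real.norm_eq_abs, abs_mul]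
          apply ENNReal.ofReal_le_ofReal
          have hu0 : 0 < u x := hk.trans hx
          have hvx : |v x| ≤ u x := by
            simp only [hv]
            rw [max_eq_left (by linarith), abs_of_pos (by linarith)]
            linarith
          have hqx := hq x hxΩ
          have key : ∀ e : ℝ, 1 ≤ e → e ≤ max (p x x) (q x) →
              u x ^ e ≤ 1 + u x ^ max (p x x) (q x) := by
            intro e he1 he
            rcases le_total 1 (u x) with h | h
            · linarith [Real.rpow_le_rpow_of_exponent_le h he]
            · linarith [Real.rpow_le_one hu0.le h (by linarith : 0 ≤ e),
                Real.rpow_nonneg hu0.le (max (p x x) (q x))]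
          have k1 := key 1 le_rfl (hqx.trans (le_max_right _ _))
          have k2 := key (q x) hqx (le_max_right _ _)
          rw [Real.rpow_one] at k1
          have h2 := hfx (u x)
          rw [abs_of_pos hu0] at h2 ⊢
          calc |f x (u x)| * |v x| ≤ C * (1 + u x ^ (q x - 1)) * u x := by gcongr
            _ = C * (u x + u x ^ (q x)) := by
                rw [mul_assoc, add_mul, one_mul, ← Real.rpow_add_one hu0.ne']
                ring_nf
            _ ≤ C * ((1 + u x ^ max (p x x) (q x)) + (1 + u x ^ max (p x x) (q x))) := by gcongr
            _ = _ := by ring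
        · have : v x = 0 := by
            simp only [hv]
            exact max_eq_right (by linarith)
          simp [this]
    _ = _ := by
        rw [lintegral_indicator hmk, Measure.restrict_restrict hmk, inter_comm,
          lintegral_const_mul' _ _ ENNReal.ofReal_ne_top]

/-- Finite covering of a bounded set by balls on which the exponents are nearly constant. -/
lemma exists_finite_cover {N : ℕ} (hN : 0 < N) {Ω : Set (EuclideanSpace ℝ (Fin N))}
    (hΩb : Bornology.IsBounded Ω) {s : ℝ} (hs : 0 < s)
    {p : EuclideanSpace ℝ (Fin N) → EuclideanSpace ℝ (Fin N) → ℝ}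
    (hp_cont : Continuous
      (fun z : EuclideanSpace ℝ (Fin N) × EuclideanSpace ℝ (Fin N) => p z.1 z.2))
    (hp : ∀ x y, 1 < p x y) (hpN : ∀ x, s * p x x < N)
    {q : EuclideanSpace ℝ (Fin N) → ℝ} (hq_cont : ContinuousOn q (closure Ω))
    (hq_sub : ∀ x ∈ closure Ω, q x < N * p x x / (N - s * p x x)) :
    ∃ (t : Finset (EuclideanSpace ℝ (Fin N))) (R P Q : EuclideanSpace ℝ (Fin N) → ℝ),
      (∀ z ∈ t, 0 < R z ∧ 1 < P z ∧ s * P z < N ∧ 1 < Q z ∧ Q z < N * P z / (N - s * P z) ∧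
        (∀ x ∈ ball z (R z), ∀ y ∈ ball z (R z), P z ≤ p x y) ∧
        ∀ x ∈ ball z (R z) ∩ Ω, max (p x x) (q x) ≤ Q z) ∧
      Ω ⊆ ⋃ z ∈ t, ball z (R z) := by
  have hN' : (0 : ℝ) < N := by exact_mod_cast hN
  have hloc : ∀ z ∈ closure Ω, ∃ R P Q : ℝ, 0 < R ∧ 1 < P ∧ s * P < N ∧ 1 < Q ∧
      Q < N * P / (N - s * P) ∧ (∀ x ∈ ball z R, ∀ y ∈ ball z R, P ≤ p x y) ∧
        ∀ x ∈ ball z R ∩ Ω, max (p x x) (q x) ≤ Q := by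
    intro z hz
    have hz1 := hp z z
    have hz2 := hpN z
    have hz3 : max (p z z) (q z) < N * p z z / (N - s * p z z) := by
      refine max_lt ?_ (hq_sub z hz)
      rw [lt_div_iff₀ (by linarith)]
      have : 0 < s * p z z := by positivity
      nlinarith
    obtain ⟨Q, hQ1, hQ2⟩ := exists_between hz3
    have hcont : ContinuousAt (fun P : ℝ => N * P / (N - s * P)) (p z z) := by
      refine ContinuousAt.div (by fun_prop) (by fun_prop) ?_
      linarith
    have hev : ∀ᶠ P in 𝓝[<] (p z z), (1 < P ∧ s * P < N) ∧ Q < N * P / (N - s * P) ∧ P < p z z := by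
      refine (((eventually_gt_nhds hz1).and ?_).filter_mono nhdsWithin_le_nhds).and
        (((hcont.eventually (lt_mem_nhds hQ2)).filter_mono nhdsWithin_le_nhds).and
          self_mem_nhdsWithin)
      exact (show ContinuousAt (fun P : ℝ => s * P) (p z z) by fun_prop).eventually
        (gt_mem_nhds hz2)
    obtain ⟨P, ⟨hP1, hP2⟩, hP3, hP4⟩ := hev.exists
    have e1 : ∀ᶠ w in 𝓝 (z, z), P < p w.1 w.2 :=
      (hp_cont.continuousAt (x := (z, z))).eventually (lt_mem_nhds hP4)
    obtain ⟨R₁, hR₁, h1⟩ := Metric.eventually_nhds_iff_ball.1 e1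
    have e2 : ∀ᶠ x in 𝓝[closure Ω] z, max (p x x) (q x) < Q := by
      have hc : ContinuousWithinAt (fun x => max (p x x) (q x)) (closure Ω) z :=
        Filter.Tendsto.max
          ((hp_cont.comp (continuous_id.prodMk continuous_id)).continuousWithinAt) (hq_cont z hz)
      exact hc.eventually (gt_mem_nhds hQ1)
    obtain ⟨R₂, hR₂, h2⟩ := Metric.mem_nhdsWithin_iff.1 e2
    refine ⟨min R₁ R₂, P, Q, lt_min hR₁ hR₂, hP1, hP2,
      hz1.trans ((le_max_left _ _).trans_lt hQ1), hP3, ?_, ?_⟩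
    · intro x hx y hy
      refine (h1 (x, y) ?_).le
      rw [← ball_prod_same]
      exact ⟨ball_subset_ball (min_le_left _ _) hx, ball_subset_ball (min_le_left _ _) hy⟩
    · intro x hx
      exact le_of_lt (h2 ⟨ball_subset_ball (min_le_right _ _) hx.1, subset_closure hx.2⟩)
  choose! R P Q h using hloc
  obtain ⟨t, ht, hcov⟩ := hΩb.isCompact_closure.elim_nhds_subcover (fun z => ball z (R z))
    fun z hz => ball_mem_nhds z (h z hz).1
  exact ⟨t, R, P, Q, fun z hz => h z (ht z hz), subset_closure.trans hcov⟩

/-- De Giorgi iteration: a superlinear level-to-level estimate forces `Z` to vanish at twice the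
initial level, if `Z` is small at that level. -/
lemma exists_deGiorgi_threshold {ι : Type*} (t : Finset ι) (β δ : ι → ℝ) (hβ : ∀ i ∈ t, 0 < β i)
    (hδ : ∀ i ∈ t, 0 < δ i) {C Q : ℝ} (hC : 0 < C) (hQ : 0 ≤ Q) :
    ∃ ε : ℝ, 0 < ε ∧ ∀ (Z : ℝ → ℝ) (k : ℝ), 0 < k → (∀ l, 0 ≤ Z l) → Antitone Z →
      (∀ l h, k ≤ l → 0 < h → Z (l + h) ≤ ∑ i ∈ t,
        C * (1 + l / h) ^ Q * (1 + h ^ (-Q)) * h ^ (-β i) * Z l ^ (1 + δ i)) →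
      (∀ i ∈ t, (1 + k ^ (-Q)) * k ^ (-β i) * Z k ^ δ i ≤ ε) → Z (2 * k) = 0 := by
  obtain ⟨r, hr0, hr1, hr⟩ : ∃ r : ℝ, 0 < r ∧ r < 1 ∧
      ∀ i ∈ t, 2 ^ (2 * Q + β i) * r ^ δ i ≤ 1 := by
    have h1 : ∀ i ∈ t, ∀ᶠ r : ℝ in 𝓝[>] 0, 2 ^ (2 * Q + β i) * r ^ δ i ≤ 1 := by
      intro i hi
      have : Tendsto (fun r : ℝ => (2 : ℝ) ^ (2 * Q + β i) * r ^ δ i) (𝓝[>] 0)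
          (𝓝 (2 ^ (2 * Q + β i) * 0 ^ δ i)) :=
        ((Real.continuousAt_rpow_const 0 (δ i) (Or.inr (hδ i hi).le)).tendsto.mono_left
          nhdsWithin_le_nhds).const_mul _
      rw [Real.zero_rpow (hδ i hi).ne', mul_zero] at this
      exact (this.eventually (gt_mem_nhds one_pos)).mono fun _ h => h.le
    have h2 := (t.eventually_all).2 h1
    obtain ⟨r, hr, hr'⟩ := (h2.and (Ioo_mem_nhdsGT one_pos)).exists
    exact ⟨r, hr'.1, hr'.2, hr⟩
  set S : ℝ := ∑ i ∈ t, C * 2 ^ (4 * Q + β i) with hS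
  have hS0 : 0 ≤ S := Finset.sum_nonneg fun i _ => by positivity
  refine ⟨r / (S + 1), by positivity, ?_⟩
  intro Z k hk hZ0 hanti hrec hsmall
  set K : ℕ → ℝ := fun n => k * (2 - (1 / 2) ^ n) with hK
  have hind : ∀ n, Z (K n) ≤ Z k * r ^ n := by
    intro n
    induction n with
    | zero => simp [hK]; norm_num
    | succ n ih =>
      set h : ℝ := k * (1 / 2) ^ (n + 1) with hh
      have hh0 : 0 < h := by positivity
      have hKn : K (n + 1) = K n + h := by simp only [hK, hh]; ring
      have hpow1 : ((1 : ℝ) / 2) ^ n ≤ 1 := pow_le_one₀ (by norm_num) (by norm_num)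
      have hkK : k ≤ K n := by
        simp only [hK]; nlinarith
      have hK2 : K n ≤ 2 * k := by
        simp only [hK]; nlinarith [pow_pos (by norm_num : (0 : ℝ) < 1 / 2) n]
      rw [hKn]
      refine (hrec _ _ hkK hh0).trans ?_
      have hinv : h⁻¹ = 2 ^ (n + 1) * k⁻¹ := by
        rw [hh, mul_inv, one_div, inv_pow, inv_inv]; ring
      have hρ : 1 + K n / h ≤ 2 ^ (n + 3) := by
        rw [div_eq_mul_inv, hinv]
        have h3 : K n * (2 ^ (n + 1) * k⁻¹) ≤ 2 * k * (2 ^ (n + 1) * k⁻¹) := by gcongr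
        have h4 : 2 * k * (2 ^ (n + 1) * k⁻¹) = 2 ^ (n + 2) := by field_simp; ring
        have h5 : (1 : ℝ) ≤ 2 ^ (n + 2) := one_le_pow₀ (by norm_num)
        rw [pow_succ (2 : ℝ) (n + 2)]
        linarith
      have hneg : ∀ e : ℝ, h ^ (-e) = (2 : ℝ) ^ ((n + 1 : ℝ) * e) * k ^ (-e) := by
        intro e
        rw [Real.rpow_neg hh0.le, ← Real.inv_rpow hh0.le, hinv,
          Real.mul_rpow (by positivity) (by positivity), Real.inv_rpow hk.le, Real.rpow_neg hk.le,
          ← Real.rpow_natCast, ← Real.rpow_mul (by norm_num)]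
        push_cast; rfl
      have hterm : ∀ i ∈ t, C * (1 + K n / h) ^ Q * (1 + h ^ (-Q)) * h ^ (-β i) *
          Z (K n) ^ (1 + δ i) ≤ C * 2 ^ (4 * Q + β i) * (r / (S + 1)) * (Z k * r ^ n) := by
        intro i hi
        have hδi := hδ i hi
        have hβi := hβ i hi
        have hZk := hZ0 k
        have a1 : (1 + K n / h) ^ Q ≤ 2 ^ ((n + 3 : ℝ) * Q) := by
          refine (Real.rpow_le_rpow (by have := hk.trans_le hkK; positivity) hρ hQ).trans
            (le_of_eq ?_)
          rw [← Real.rpow_natCast, ← Real.rpow_mul (by norm_num)]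
          push_cast; rfl
        have a2 : 1 + h ^ (-Q) ≤ 2 ^ ((n + 1 : ℝ) * Q) * (1 + k ^ (-Q)) := by
          rw [hneg, mul_add, mul_one]
          gcongr
          exact Real.one_le_rpow (by norm_num) (by positivity)
        have a3 : Z (K n) ^ (1 + δ i) ≤ (Z k * r ^ n) * (Z k ^ δ i * (r ^ δ i) ^ n) := by
          refine (Real.rpow_le_rpow (hZ0 _) ih (by positivity)).trans (le_of_eq ?_)
          rw [Real.rpow_add_of_nonneg (by positivity) zero_le_one hδi.le, Real.rpow_one,
            Real.mul_rpow hZk (by positivity), ← Real.rpow_natCast, ← Real.rpow_natCast,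
            ← Real.rpow_mul hr0.le, ← Real.rpow_mul hr0.le]
          ring_nf
        calc C * (1 + K n / h) ^ Q * (1 + h ^ (-Q)) * h ^ (-β i) * Z (K n) ^ (1 + δ i)
            ≤ C * 2 ^ ((n + 3 : ℝ) * Q) * (2 ^ ((n + 1 : ℝ) * Q) * (1 + k ^ (-Q))) *
              (2 ^ ((n + 1 : ℝ) * β i) * k ^ (-β i)) *
              ((Z k * r ^ n) * (Z k ^ δ i * (r ^ δ i) ^ n)) := by
              rw [hneg (β i)]
              have := hZ0 (K n)
              have := hk.trans_le hkK
              gcongr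
          _ = C * (2 ^ (4 * Q + β i) * ((2 ^ (2 * Q + β i) * r ^ δ i) ^ n)) *
              ((1 + k ^ (-Q)) * k ^ (-β i) * Z k ^ δ i) * (Z k * r ^ n) := by
              have : (2 : ℝ) ^ ((n + 3 : ℝ) * Q) * 2 ^ ((n + 1 : ℝ) * Q) *
                  2 ^ ((n + 1 : ℝ) * β i) = 2 ^ (4 * Q + β i) * (2 ^ (2 * Q + β i)) ^ n := by
                rw [← Real.rpow_natCast, ← Real.rpow_mul (by norm_num),
                  ← Real.rpow_add (by norm_num), ← Real.rpow_add (by norm_num),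
                  ← Real.rpow_add (by norm_num)]
                ring_nf
              rw [mul_pow, ← mul_assoc (2 ^ (4 * Q + β i)), ← this]
              ring
          _ ≤ C * (2 ^ (4 * Q + β i) * 1) * (r / (S + 1)) * (Z k * r ^ n) := by
              have := hsmall i hi
              have := pow_le_one₀ (n := n) (by positivity) (hr i hi)
              gcongr
          _ = _ := by ring
      refine (Finset.sum_le_sum hterm).trans ?_
      rw [← Finset.sum_mul, ← Finset.sum_mul, ← hS, pow_succ]
      have hZk := hZ0 k
      have : S * (r / (S + 1)) ≤ r := by
        rw [mul_div_assoc', div_le_iff₀ (by positivity)]; nlinarith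
      calc _ ≤ r * (Z k * r ^ n) := by gcongr
        _ = _ := by ring
  have hlim : Tendsto (fun n => Z k * r ^ n) atTop (𝓝 0) := by
    simpa using (tendsto_pow_atTop_nhds_zero_of_lt_one hr0.le hr1).const_mul (Z k)
  refine le_antisymm (ge_of_tendsto' hlim fun n => (hanti ?_).trans (hind n)) (hZ0 _)
  simp only [hK]
  nlinarith [pow_pos (by norm_num : (0 : ℝ) < 1 / 2) n]

/-- Choice of the initial level as a power of the size `l` of the data. -/
lemma exists_initial_level {ι : Type*} (t : Finset ι) (β δ : ι → ℝ) (hβ : ∀ i ∈ t, 0 < β i)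
    (hδ : ∀ i ∈ t, 0 < δ i) {Q c ε : ℝ} (hQ : 1 ≤ Q) (hc : 0 < c) (hε : 0 < ε) :
    ∃ K a b : ℝ, 0 < K ∧ 0 < a ∧ 0 < b ∧ ∀ l k : ℝ, 0 < l → k = K * max (l ^ a) (l ^ b) →
      l ≤ k ∧ l / k ≤ c ∧ ∀ Z₀ : ℝ, 0 ≤ Z₀ → Z₀ ≤ l / k + (l + l ^ Q) →
        ∀ i ∈ t, (1 + k ^ (-Q)) * k ^ (-β i) * Z₀ ^ δ i ≤ ε := by
  obtain ⟨a, ha, ha0, ha1⟩ : ∃ a : ℝ, (∀ i ∈ t, a * (Q + β i + δ i) < δ i) ∧ 0 < a ∧ a < 1 := by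
    have h1 : ∀ i ∈ t, ∀ᶠ a : ℝ in 𝓝[>] 0, a * (Q + β i + δ i) < δ i := by
      intro i hi
      have : Tendsto (fun a : ℝ => a * (Q + β i + δ i)) (𝓝[>] 0) (𝓝 (0 * (Q + β i + δ i))) :=
        (tendsto_id.mono_left nhdsWithin_le_nhds).mul_const _
      rw [zero_mul] at this
      exact this.eventually (gt_mem_nhds (hδ i hi))
    obtain ⟨a, h, h'⟩ := (((t.eventually_all).2 h1).and (Ioo_mem_nhdsGT one_pos)).exists
    exact ⟨a, h, h'.1, h'.2⟩
  obtain ⟨b, hb, hb1⟩ : ∃ b : ℝ, (∀ i ∈ t, Q * δ i ≤ b * β i) ∧ 1 ≤ b := by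
    have h1 : ∀ i ∈ t, ∀ᶠ b : ℝ in atTop, Q * δ i ≤ b * β i := fun i hi =>
      (tendsto_id.atTop_mul_const (hβ i hi)).eventually (eventually_ge_atTop _)
    exact (((t.eventually_all).2 h1).and (eventually_ge_atTop 1)).exists
  obtain ⟨K, hKε, hKc, hK1⟩ : ∃ K : ℝ, (∀ i ∈ t, 2 * 3 ^ δ i * K ^ (-β i) < ε) ∧ K⁻¹ < c ∧
      1 ≤ K := by
    have h1 : ∀ i ∈ t, ∀ᶠ K : ℝ in atTop, 2 * 3 ^ δ i * K ^ (-β i) < ε := by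
      intro i hi
      have := (tendsto_rpow_neg_atTop (hβ i hi)).const_mul (2 * (3 : ℝ) ^ δ i)
      rw [mul_zero] at this
      exact this.eventually (gt_mem_nhds hε)
    exact (((t.eventually_all).2 h1).and
      ((tendsto_inv_atTop_zero.eventually (gt_mem_nhds hc)).and (eventually_ge_atTop 1))).exists
  have hK0 : 0 < K := by linarith
  refine ⟨K, a, b, hK0, ha0, by linarith, ?_⟩
  intro l k hl hk
  rcases le_total l 1 with hl1 | hl1
  · rw [max_eq_left (Real.rpow_le_rpow_of_exponent_ge hl hl1 (by linarith))] at hk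
    have hlow : ∀ e, 1 - a ≤ e → l ^ e ≤ l ^ (1 - a) := fun e he =>
      Real.rpow_le_rpow_of_exponent_ge hl hl1 he
    have hla : l ^ (1 - a) ≤ 1 := Real.rpow_le_one hl.le hl1 (by linarith)
    have hlk : l / k = K⁻¹ * l ^ (1 - a) := by
      rw [hk, Real.rpow_sub hl, Real.rpow_one]; field_simp
    have hKinv : K⁻¹ ≤ 1 := inv_le_one_of_one_le₀ hK1
    have hneg : ∀ e : ℝ, k ^ (-e) = K ^ (-e) * l ^ (-(a * e)) := fun e => by
      rw [hk, Real.mul_rpow hK0.le (by positivity), ← Real.rpow_mul hl.le]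
      ring_nf
    have hk0 : 0 < k := by rw [hk]; positivity
    have hlkc : l / k ≤ K⁻¹ := by
      rw [hlk]; exact mul_le_of_le_one_right (by positivity) hla
    refine ⟨(div_le_one hk0).1 (hlkc.trans hKinv), hlkc.trans hKc.le, ?_⟩
    intro Z₀ hZ0 hZ i hi
    have hβi := hβ i hi
    have hδi := hδ i hi
    have hZ3 : Z₀ ≤ 3 * l ^ (1 - a) := by
      have h1 := hlow 1 (by linarith)
      have h2 := hlow Q (by linarith)
      rw [Real.rpow_one] at h1
      have h3 : l / k ≤ l ^ (1 - a) := by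
        rw [hlk]; exact mul_le_of_le_one_left (by positivity) hKinv
      linarith
    have b1 : 1 + k ^ (-Q) ≤ 2 * l ^ (-(a * Q)) := by
      have h1 : 1 ≤ l ^ (-(a * Q)) :=
        Real.one_le_rpow_of_pos_of_le_one_of_nonpos hl hl1 (by
          have : 0 < a * Q := by positivity
          linarith)
      have h2 : K ^ (-Q) ≤ 1 := Real.rpow_le_one_of_one_le_of_nonpos hK1 (by linarith)
      have h3 : K ^ (-Q) * l ^ (-(a * Q)) ≤ l ^ (-(a * Q)) :=
        mul_le_of_le_one_left (by positivity) h2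
      rw [hneg]; linarith
    have b2 : Z₀ ^ δ i ≤ 3 ^ δ i * l ^ ((1 - a) * δ i) := by
      refine (Real.rpow_le_rpow hZ0 hZ3 hδi.le).trans (le_of_eq ?_)
      rw [Real.mul_rpow (by norm_num) (by positivity), ← Real.rpow_mul hl.le]
    have b3 : l ^ (-(a * Q)) * l ^ (-(a * β i)) * l ^ ((1 - a) * δ i) ≤ 1 := by
      rw [← Real.rpow_add hl, ← Real.rpow_add hl]
      refine Real.rpow_le_one hl.le hl1 ?_
      have := ha i hi
      nlinarith
    calc _ ≤ (2 * l ^ (-(a * Q))) * (K ^ (-β i) * l ^ (-(a * β i))) *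
          (3 ^ δ i * l ^ ((1 - a) * δ i)) := by rw [hneg (β i)]; gcongr
      _ = (2 * 3 ^ δ i * K ^ (-β i)) *
          (l ^ (-(a * Q)) * l ^ (-(a * β i)) * l ^ ((1 - a) * δ i)) := by ring
      _ ≤ ε * 1 := by
          have := hKε i hi
          gcongr
      _ = ε := mul_one _
  · rw [max_eq_right (Real.rpow_le_rpow_of_exponent_le hl1 (by linarith))] at hk
    have hlb : l ≤ l ^ b := by
      simpa using Real.rpow_le_rpow_of_exponent_le hl1 hb1
    have hneg : ∀ e : ℝ, k ^ (-e) = K ^ (-e) * l ^ (-(b * e)) := fun e => by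
      rw [hk, Real.mul_rpow hK0.le (by positivity), ← Real.rpow_mul hl.le]
      ring_nf
    have hk0 : 0 < k := by rw [hk]; positivity
    have hKinv : K⁻¹ ≤ 1 := inv_le_one_of_one_le₀ hK1
    have hlkc : l / k ≤ K⁻¹ := by
      rw [div_le_iff₀ hk0, hk, ← mul_assoc, inv_mul_cancel₀ hK0.ne', one_mul]
      exact hlb
    have hlk : l ≤ k := (div_le_one hk0).1 (hlkc.trans hKinv)
    refine ⟨hlk, hlkc.trans hKc.le, ?_⟩
    intro Z₀ hZ0 hZ i hi
    have hβi := hβ i hi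
    have hδi := hδ i hi
    have hZ3 : Z₀ ≤ 3 * l ^ Q := by
      have h1 : l ≤ l ^ Q := by simpa using Real.rpow_le_rpow_of_exponent_le hl1 hQ
      linarith
    have b1 : 1 + k ^ (-Q) ≤ 2 := by
      have : k ^ (-Q) ≤ 1 := Real.rpow_le_one_of_one_le_of_nonpos (hl1.trans hlk) (by linarith)
      linarith
    have b2 : Z₀ ^ δ i ≤ 3 ^ δ i * l ^ (Q * δ i) := by
      refine (Real.rpow_le_rpow hZ0 hZ3 hδi.le).trans (le_of_eq ?_)
      rw [Real.mul_rpow (by norm_num) (by positivity), ← Real.rpow_mul hl.le]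
    have b3 : l ^ (-(b * β i)) * l ^ (Q * δ i) ≤ 1 := by
      rw [← Real.rpow_add hl]
      refine Real.rpow_le_one_of_one_le_of_nonpos hl1 ?_
      have := hb i hi
      linarith
    calc _ ≤ 2 * (K ^ (-β i) * l ^ (-(b * β i))) * (3 ^ δ i * l ^ (Q * δ i)) := by
          rw [hneg (β i)]; gcongr
      _ = (2 * 3 ^ δ i * K ^ (-β i)) * (l ^ (-(b * β i)) * l ^ (Q * δ i)) := by ring
      _ ≤ ε * 1 := by
          have := hKε i hi
          gcongr
      _ = ε := mul_one _

lemma lintegral_biUnion_finset_le {α ι : Type*} [MeasurableSpace α] {μ : Measure α}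
    (f : α → ℝ≥0∞) (t : Finset ι) (S : ι → Set α) :
    ∫⁻ x in ⋃ i ∈ t, S i, f x ∂μ ≤ ∑ i ∈ t, ∫⁻ x in S i, f x ∂μ := by
  classical
  induction t using Finset.induction_on with
  | empty => simp
  | insert a t ha ih =>
    rw [Finset.set_biUnion_insert, Finset.sum_insert ha]
    exact (lintegral_union_le f _ _).trans (by gcongr)

lemma one_add_rpow_le {a k h m e Q : ℝ} (hk : 0 ≤ k) (hh : 0 < h) (ha : k + h < a) (hm : 0 ≤ m)
    (hme : m ≤ e) (heQ : e ≤ Q) :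
    1 + a ^ m ≤ 2 * (1 + k / h) ^ Q * (1 + h ^ (-Q)) * (a - k) ^ e := by
  have hw : h < a - k := by linarith
  have hw0 : 0 < a - k := hh.trans hw
  have key : ∀ r, 0 ≤ r → r ≤ e → (a - k) ^ r ≤ (1 + h ^ (-Q)) * (a - k) ^ e := by
    intro r hr hre
    have h1 : (a - k) ^ r = (a - k) ^ (-(e - r)) * (a - k) ^ e := by
      rw [← Real.rpow_add hw0]; ring_nf
    have h2 : (a - k) ^ (-(e - r)) ≤ h ^ (-(e - r)) :=
      Real.rpow_le_rpow_of_nonpos hh hw.le (by linarith)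
    have h3 : h ^ (-(e - r)) ≤ 1 + h ^ (-Q) := by
      rcases le_total 1 h with h4 | h4
      · have := Real.rpow_le_one_of_one_le_of_nonpos h4 (by linarith : -(e - r) ≤ 0)
        have := Real.rpow_nonneg hh.le (-Q)
        linarith
      · have := Real.rpow_le_rpow_of_exponent_ge hh h4 (by linarith : -Q ≤ -(e - r))
        linarith
    rw [h1]
    gcongr
    exact h2.trans h3
  have hρ : 1 ≤ 1 + k / h := by
    have : 0 ≤ k / h := by positivity
    linarith
  have hρQ : 1 ≤ (1 + k / h) ^ Q := Real.one_le_rpow hρ (by linarith)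
  have haw : a ≤ (1 + k / h) * (a - k) := by
    have : k / h * h ≤ k / h * (a - k) := by gcongr
    rw [div_mul_cancel₀ _ hh.ne'] at this
    linarith
  have k0 := key 0 le_rfl (hm.trans hme)
  have k1 := key m hm hme
  rw [Real.rpow_zero] at k0
  set X := (1 + h ^ (-Q)) * (a - k) ^ e
  have h1 : a ^ m ≤ (1 + k / h) ^ Q * X := by
    calc a ^ m ≤ ((1 + k / h) * (a - k)) ^ m := by
          have : 0 ≤ a := by linarith
          gcongr
      _ = (1 + k / h) ^ m * (a - k) ^ m := Real.mul_rpow (by linarith) hw0.le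
      _ ≤ (1 + k / h) ^ Q * X := by
          have := Real.rpow_le_rpow_of_exponent_le hρ (hme.trans heQ)
          gcongr
  have h2 : 1 ≤ (1 + k / h) ^ Q * X := k0.trans (le_mul_of_one_le_left (by linarith) hρQ)
  calc 1 + a ^ m ≤ (1 + k / h) ^ Q * X + (1 + k / h) ^ Q * X := add_le_add h2 h1
    _ = _ := by ring

/-- The integral of `1 + |u|^m` over the superlevel set `Ω ∩ {u > k}`. -/
def superlevelMod {N : ℕ} (Ω : Set (EuclideanSpace ℝ (Fin N))) (m : EuclideanSpace ℝ (Fin N) → ℝ)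
    (u : EuclideanSpace ℝ (Fin N) → ℝ) (k : ℝ) : ℝ≥0∞ :=
  ∫⁻ x in Ω ∩ {x | k < u x}, ENNReal.ofReal (1 + |u x| ^ m x)

/-- The Gagliardo modular of the truncation `(u - k)⁺` controls the superlevel modular at level
`k + h` superlinearly. -/
def SuperlevelRecursion {N : ℕ} (Ω : Set (EuclideanSpace ℝ (Fin N))) (s : ℝ)
    (p : EuclideanSpace ℝ (Fin N) → EuclideanSpace ℝ (Fin N) → ℝ)
    (m : EuclideanSpace ℝ (Fin N) → ℝ) (t : Finset (EuclideanSpace ℝ (Fin N)))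
    (β δ : EuclideanSpace ℝ (Fin N) → ℝ) (C Q c : ℝ) : Prop :=
  ∀ u : EuclideanSpace ℝ (Fin N) → ℝ, Measurable u → ∀ k h D : ℝ, 0 < k → 0 < h →
    volume {x | k < u x} ≤ ENNReal.ofReal c → 0 ≤ D → volume {x | k < u x} ≤ ENNReal.ofReal D →
    gagMod univ s p (fun x => max (u x - k) 0) ≤ ENNReal.ofReal D →
    superlevelMod Ω m u (k + h) ≤
      ENNReal.ofReal (∑ i ∈ t, C * (1 + k / h) ^ Q * (1 + h ^ (-Q)) * h ^ (-β i) * D ^ (1 + δ i))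

/-- Level-to-level estimate for the modular on superlevel sets. -/
lemma exists_superlevel_recursion {N : ℕ} (hN : 0 < N) {Ω : Set (EuclideanSpace ℝ (Fin N))}
    (hΩ : MeasurableSet Ω) (hΩb : Bornology.IsBounded Ω) {s : ℝ} (hs : 0 < s)
    {p : EuclideanSpace ℝ (Fin N) → EuclideanSpace ℝ (Fin N) → ℝ}
    (hp_cont : Continuous
      (fun z : EuclideanSpace ℝ (Fin N) × EuclideanSpace ℝ (Fin N) => p z.1 z.2))
    (hp : ∀ x y, 1 < p x y) (hpN : ∀ x, s * p x x < N)
    {q : EuclideanSpace ℝ (Fin N) → ℝ} (hq_cont : ContinuousOn q (closure Ω))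
    (hq_sub : ∀ x ∈ closure Ω, q x < N * p x x / (N - s * p x x)) :
    ∃ (t : Finset (EuclideanSpace ℝ (Fin N))) (β δ : EuclideanSpace ℝ (Fin N) → ℝ) (C Q c : ℝ),
      (∀ i ∈ t, 0 < β i) ∧ (∀ i ∈ t, 0 < δ i) ∧ 0 < C ∧ 1 ≤ Q ∧ 0 < c ∧
      (∀ x ∈ Ω, max (p x x) (q x) ≤ Q) ∧
      SuperlevelRecursion Ω s p (fun x => max (p x x) (q x)) t β δ C Q c := by
  have hN' : (0 : ℝ) < N := by exact_mod_cast hN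
  obtain ⟨t, R, P, Qx, ht, hcov⟩ := exists_finite_cover hN hΩb hs hp_cont hp hpN hq_cont hq_sub
  have hloc := fun i (hi : i ∈ t) =>
    exists_local_gain (Q := Qx i) hN hs (zero_lt_one.trans (ht i hi).2.1) (ht i hi).2.2.1
      (zero_lt_one.trans (ht i hi).2.2.2.1) (ht i hi).2.2.2.2.1 (ht i hi).1
  choose! C hC0 c hc0 hloc using hloc
  obtain ⟨c', hc', hc'0⟩ : ∃ c' : ℝ, (∀ i ∈ t, c' < c i) ∧ 0 < c' := by
    have h1 : ∀ i ∈ t, ∀ᶠ a : ℝ in 𝓝[>] 0, a < c i := fun i hi =>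
      (gt_mem_nhds (hc0 i hi)).filter_mono nhdsWithin_le_nhds
    exact (((t.eventually_all).2 h1).and self_mem_nhdsWithin).exists
  set Q : ℝ := ∑ i ∈ t, Qx i + 1 with hQ
  have hQx : ∀ i ∈ t, Qx i ≤ Q := fun i hi => by
    have := Finset.single_le_sum (f := Qx) (fun j hj => (zero_lt_one.trans (ht j hj).2.2.2.1).le) hi
    linarith
  have hQ1 : 1 ≤ Q := by
    have := Finset.sum_nonneg (f := Qx) fun j hj => (zero_lt_one.trans (ht j hj).2.2.2.1).le
    linarith
  set C' : ℝ := 2 * ∑ i ∈ t, C i + 1 with hC'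
  have hCsum : 0 ≤ ∑ i ∈ t, C i := Finset.sum_nonneg fun j hj => (hC0 j hj).le
  have hCi : ∀ i ∈ t, 2 * C i ≤ C' := fun i hi => by
    have := Finset.single_le_sum (f := C) (fun j hj => (hC0 j hj).le) hi
    linarith
  refine ⟨t, fun i => N * P i / (N - s * P i) - Qx i, fun i => s * P i / (N - s * P i), C', Q, c',
    fun i hi => sub_pos.2 (ht i hi).2.2.2.2.1, fun i hi => ?_, by positivity, hQ1, hc'0, ?_, ?_⟩
  · have h1 := (ht i hi).2.1
    have h2 := (ht i hi).2.2.1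
    exact div_pos (by positivity) (by linarith)
  · intro x hx
    obtain ⟨i, hi, hxi⟩ := mem_iUnion₂.1 (hcov hx)
    exact ((ht i hi).2.2.2.2.2.2 x ⟨hxi, hx⟩).trans (hQx i hi)
  intro u hu k h D hk hh hvc hD hvD hE
  have hm : ∀ l : ℝ, MeasurableSet {x | l < u x} := fun l => measurableSet_lt measurable_const hu
  have hp0 : ∀ x y, 0 ≤ p x y := fun x y => (zero_lt_one.trans (hp x y)).le
  have hball : ∀ i ∈ t, ∫⁻ x in ball i (R i) ∩ (Ω ∩ {x | k + h < u x}),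
      ENNReal.ofReal (1 + |u x| ^ max (p x x) (q x)) ≤
      ENNReal.ofReal (C' * (1 + k / h) ^ Q * (1 + h ^ (-Q)) *
        h ^ (-(N * P i / (N - s * P i) - Qx i)) * D ^ (1 + s * P i / (N - s * P i))) := by
    intro i hi
    obtain ⟨hR, hP, hsP, hQi, hQP, hpP, hmQ⟩ := ht i hi
    have hNP : 0 < N - s * P i := by linarith
    have hvol : volume (ball i (R i) ∩ {x | k < u x}) ≤ volume {x | k < u x} :=
      measure_mono inter_subset_right
    have hgain := hloc i hi i p u k h D hp0 hpP hu hh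
      (ENNReal.toReal_le_of_le_ofReal (hc0 i hi).le ((hvol.trans hvc).trans
        (ENNReal.ofReal_le_ofReal (hc' i hi).le)))
      (ENNReal.toReal_le_of_le_ofReal hD (hvol.trans hvD))
      ((gagMod_mono (subset_univ _) s hp0 fun x y => le_rfl).trans hE)
    have hfac : 0 ≤ 2 * (1 + k / h) ^ Q * (1 + h ^ (-Q)) := by positivity
    calc _ ≤ ∫⁻ x in ball i (R i) ∩ (Ω ∩ {x | k + h < u x}),
          ENNReal.ofReal (2 * (1 + k / h) ^ Q * (1 + h ^ (-Q))) *
            ENNReal.ofReal ((u x - k) ^ Qx i) := by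
          refine setLIntegral_mono' (measurableSet_ball.inter (hΩ.inter (hm _))) fun x hx => ?_
          have hxu : k + h < u x := hx.2.2
          rw [← ENNReal.ofReal_mul hfac, abs_of_pos (by linarith)]
          refine ENNReal.ofReal_le_ofReal (one_add_rpow_le hk.le hh hxu ?_ ?_ (hQx i hi))
          · exact (hp0 x x).trans (le_max_left _ _)
          · exact hmQ x ⟨hx.1, hx.2.1⟩
      _ = ENNReal.ofReal (2 * (1 + k / h) ^ Q * (1 + h ^ (-Q))) *
          ∫⁻ x in ball i (R i) ∩ (Ω ∩ {x | k + h < u x}), ENNReal.ofReal ((u x - k) ^ Qx i) :=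
          lintegral_const_mul' _ _ ENNReal.ofReal_ne_top
      _ ≤ ENNReal.ofReal (2 * (1 + k / h) ^ Q * (1 + h ^ (-Q))) *
          ENNReal.ofReal (C i * h ^ (-(N * P i / (N - s * P i) - Qx i)) *
            D ^ (N / (N - s * P i))) := by
          gcongr
          refine le_trans (lintegral_mono_set ?_) hgain
          exact inter_subset_inter_right _ inter_subset_right
      _ ≤ _ := by
          rw [← ENNReal.ofReal_mul hfac]
          apply ENNReal.ofReal_le_ofReal
          have e1 : 1 + s * P i / (N - s * P i) = N / (N - s * P i) := by field_simp; ring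
          rw [e1]
          calc _ = 2 * C i * (1 + k / h) ^ Q * (1 + h ^ (-Q)) *
                h ^ (-(N * P i / (N - s * P i) - Qx i)) * D ^ (N / (N - s * P i)) := by ring
            _ ≤ _ := by
                have := hCi i hi
                gcongr
  unfold superlevelMod
  calc _ ≤ ∫⁻ x in ⋃ i ∈ t, ball i (R i) ∩ (Ω ∩ {x | k + h < u x}),
        ENNReal.ofReal (1 + |u x| ^ max (p x x) (q x)) := by
        refine lintegral_mono_set fun x hx => ?_
        obtain ⟨i, hi, hxi⟩ := mem_iUnion₂.1 (hcov hx.1)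
        exact mem_iUnion₂.2 ⟨i, hi, hxi, hx⟩
    _ ≤ ∑ i ∈ t, ∫⁻ x in ball i (R i) ∩ (Ω ∩ {x | k + h < u x}),
        ENNReal.ofReal (1 + |u x| ^ max (p x x) (q x)) := by
        exact lintegral_biUnion_finset_le _ _ _
    _ ≤ ∑ i ∈ t, ENNReal.ofReal (C' * (1 + k / h) ^ Q * (1 + h ^ (-Q)) *
        h ^ (-(N * P i / (N - s * P i) - Qx i)) * D ^ (1 + s * P i / (N - s * P i))) :=
        Finset.sum_le_sum hball
    _ = _ := by
        rw [ENNReal.ofReal_sum_of_nonneg]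
        intro i hi
        positivity

lemma volume_le_of_le_rpow {N : ℕ} {A B : Set (EuclideanSpace ℝ (Fin N))} (hA : MeasurableSet A)
    (hAB : A ⊆ B) {u e : EuclideanSpace ℝ (Fin N) → ℝ} {a b : ℝ} (ha : 0 < a)
    (h : ∀ x ∈ A, a ≤ |u x| ^ e x) (hb : modLq B e u ≤ ENNReal.ofReal b) :
    volume A ≤ ENNReal.ofReal (b / a) := by
  rw [ENNReal.ofReal_div_of_pos ha, ENNReal.le_div_iff_mul_le
    (Or.inl (ENNReal.ofReal_pos.2 ha).ne') (Or.inl ENNReal.ofReal_ne_top), mul_comm,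
    ← setLIntegral_const]
  exact ((setLIntegral_mono' hA fun x hx => ENNReal.ofReal_le_ofReal (h x hx)).trans
    (lintegral_mono_set hAB)).trans hb

lemma gagMod_neg {N : ℕ} (Ω : Set (EuclideanSpace ℝ (Fin N))) (s : ℝ)
    (p : EuclideanSpace ℝ (Fin N) → EuclideanSpace ℝ (Fin N) → ℝ)
    (u : EuclideanSpace ℝ (Fin N) → ℝ) : gagMod Ω s p (fun x => -u x) = gagMod Ω s p u := by
  have h : ∀ x y, |-u x - -u y| = |u x - u y| := fun x y => by
    rw [← abs_neg (u x - u y)]; ring_nf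
  simp only [gagMod, h]

lemma memW0.neg {N : ℕ} {Ω : Set (EuclideanSpace ℝ (Fin N))} {s : ℝ}
    {p : EuclideanSpace ℝ (Fin N) → EuclideanSpace ℝ (Fin N) → ℝ}
    {u : EuclideanSpace ℝ (Fin N) → ℝ} (hu : memW0 Ω s p u) : memW0 Ω s p fun x => -u x := by
  obtain ⟨hm, hL, hG, h0⟩ := hu
  refine ⟨hm.neg, ?_, by rwa [gagMod_neg], fun x hx => by simp [h0 x hx]⟩
  simpa only [modLq, abs_neg] using hL

lemma modLq_lt_top_of_memW0 {N : ℕ} {Ω : Set (EuclideanSpace ℝ (Fin N))}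
    (hΩ : MeasurableSet Ω) (hΩb : Bornology.IsBounded Ω) {s : ℝ}
    {p : EuclideanSpace ℝ (Fin N) → EuclideanSpace ℝ (Fin N) → ℝ} (hp : ∀ x y, 1 < p x y)
    {m β δ : EuclideanSpace ℝ (Fin N) → ℝ} {t : Finset (EuclideanSpace ℝ (Fin N))} {C Q c : ℝ}
    (hm : ∀ x, 1 ≤ m x) (hmQ : ∀ x ∈ Ω, m x ≤ Q) (hc : 0 < c)
    (hrec : SuperlevelRecursion Ω s p m t β δ C Q c) {u : EuclideanSpace ℝ (Fin N) → ℝ}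
    (hu : memW0 Ω s p u) : modLq Ω m u < ⊤ := by
  have hp0 : ∀ x y, 0 ≤ p x y := fun x y => (zero_lt_one.trans (hp x y)).le
  set M := (modLq univ (fun x => p x x) u).toReal with hM
  set k := max 1 (M / c) with hk
  have hk1 : 1 ≤ k := le_max_left _ _
  have hk0 : 0 < k := by linarith
  have hMk : M / k ≤ c := by
    rw [div_le_comm₀ hk0 hc]
    exact le_max_right _ _
  have hside : ∀ v, memW0 Ω s p v → (∀ x, |v x| = |u x|) → superlevelMod Ω m v (k + k) < ⊤ := by
    intro v hv hvu
    have hvol : volume {x | k < v x} ≤ ENNReal.ofReal c := by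
      refine (volume_le_of_le_rpow (measurableSet_lt measurable_const hv.1) (subset_univ _) hk0
        (u := u) (e := fun x => p x x) (fun x hx => ?_)
        (ENNReal.ofReal_toReal hu.2.1.ne).ge).trans (ENNReal.ofReal_le_ofReal hMk)
      have h1 : k ≤ |u x| := by
        rw [← hvu]
        exact (le_of_lt hx).trans (le_abs_self _)
      exact h1.trans (Real.self_le_rpow_of_one_le (hk1.trans h1) (hp x x).le)
    set D := (gagMod univ s p v).toReal + c with hD
    have hG : 0 ≤ (gagMod univ s p v).toReal := ENNReal.toReal_nonneg
    refine (hrec v hv.1 k k D hk0 hk0 hvol (by positivity)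
      (hvol.trans (ENNReal.ofReal_le_ofReal (by linarith))) ?_).trans_lt ENNReal.ofReal_lt_top
    refine (gagMod_mono subset_rfl s hp0 fun x y => abs_max_sub_le _ _ k).trans ?_
    rw [← ENNReal.ofReal_toReal hv.2.2.1.ne]
    exact ENNReal.ofReal_le_ofReal (by linarith)
  have h1 := hside u hu fun x => rfl
  have h2 := hside _ hu.neg fun x => abs_neg _
  have h3 : ∫⁻ x in Ω ∩ {x | |u x| ≤ k + k}, ENNReal.ofReal (1 + |u x| ^ m x) < ⊤ := by
    calc _ ≤ ∫⁻ x in Ω ∩ {x | |u x| ≤ k + k}, ENNReal.ofReal (1 + (k + k) ^ Q) := by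
          refine setLIntegral_mono' (hΩ.inter (measurableSet_le hu.1.abs measurable_const))
            fun x hx => ENNReal.ofReal_le_ofReal ?_
          have hxu : |u x| ≤ k + k := hx.2
          have := hm x
          have : (k + k) ^ m x ≤ (k + k) ^ Q :=
            Real.rpow_le_rpow_of_exponent_le (by linarith) (hmQ x hx.1)
          have : |u x| ^ m x ≤ (k + k) ^ m x := by gcongr
          linarith
      _ < ⊤ := by
          rw [setLIntegral_const]
          exact ENNReal.mul_lt_top ENNReal.ofReal_lt_top
            ((measure_mono inter_subset_left).trans_lt hΩb.measure_lt_top)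
  have hcov : Ω ⊆ Ω ∩ {x | k + k < u x} ∪ Ω ∩ {x | k + k < -u x} ∪ Ω ∩ {x | |u x| ≤ k + k} := by
    intro x hx
    rcases le_or_gt |u x| (k + k) with h | h
    · exact Or.inr ⟨hx, h⟩
    · rcases lt_abs.1 h with h | h
      · exact Or.inl (Or.inl ⟨hx, h⟩)
      · exact Or.inl (Or.inr ⟨hx, h⟩)
  simp only [superlevelMod, abs_neg] at h1 h2
  calc modLq Ω m u ≤ ∫⁻ x in Ω, ENNReal.ofReal (1 + |u x| ^ m x) :=
        lintegral_mono fun x => ENNReal.ofReal_le_ofReal (by linarith)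
    _ ≤ _ := lintegral_mono_set hcov
    _ ≤ _ := lintegral_union_le _ _ _
    _ ≤ _ := add_le_add_left (lintegral_union_le _ _ _) _
    _ < ⊤ := ENNReal.add_lt_top.2 ⟨ENNReal.add_lt_top.2 ⟨h1, h2⟩, h3⟩

lemma exists_sup_bound {N : ℕ} {Ω : Set (EuclideanSpace ℝ (Fin N))}
    (hΩ : MeasurableSet Ω) (hΩb : Bornology.IsBounded Ω) {s : ℝ}
    {p : EuclideanSpace ℝ (Fin N) → EuclideanSpace ℝ (Fin N) → ℝ}
    {m β δ : EuclideanSpace ℝ (Fin N) → ℝ} {t : Finset (EuclideanSpace ℝ (Fin N))}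
    {C C₁ Q c : ℝ} (hm : ∀ x, 1 ≤ m x) (hmQ : ∀ x ∈ Ω, m x ≤ Q) (hβ : ∀ i ∈ t, 0 < β i)
    (hδ : ∀ i ∈ t, 0 < δ i) (hC : 0 < C) (hQ : 1 ≤ Q) (hc : 0 < c) (hC₁ : 1 ≤ C₁)
    (hrec : SuperlevelRecursion Ω s p m t β δ C Q c) :
    ∃ K a b : ℝ, 0 < K ∧ 0 < a ∧ 0 < b ∧ ∀ u : EuclideanSpace ℝ (Fin N) → ℝ, Measurable u →
      (∀ x, x ∉ Ω → u x = 0) →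
      (∀ k, 0 < k → gagMod univ s p (fun x => max (u x - k) 0) ≤
        ENNReal.ofReal C₁ * superlevelMod Ω m u k) →
      ∀ l, 0 < l → modLq Ω m (fun x => u x / l) ≤ 1 →
        volume {x | 2 * (K * max (l ^ a) (l ^ b)) < u x} = 0 := by
  have hC₁0 : 0 < C₁ := by linarith
  have hsum : ∀ i ∈ t, C * C₁ ^ (1 + δ i) ≤ ∑ i ∈ t, C * C₁ ^ (1 + δ i) + 1 := fun i hi => by
    have := Finset.single_le_sum (f := fun i => C * C₁ ^ (1 + δ i))
      (fun j hj => by positivity) hi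
    linarith
  have hsum0 : 0 ≤ ∑ i ∈ t, C * C₁ ^ (1 + δ i) := Finset.sum_nonneg fun j hj => by positivity
  obtain ⟨ε, hε, hdg⟩ := exists_deGiorgi_threshold t β δ hβ hδ
    (C := ∑ i ∈ t, C * C₁ ^ (1 + δ i) + 1) (Q := Q) (by positivity) (by linarith)
  obtain ⟨K, a, b, hK, ha, hb, hinit⟩ := exists_initial_level t β δ hβ hδ hQ hc hε
  refine ⟨K, a, b, hK, ha, hb, fun u hu hu0 hgag l hl hmod => ?_⟩
  set k := K * max (l ^ a) (l ^ b) with hk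
  obtain ⟨hlk, hlkc, hinit⟩ := hinit l k hl hk
  have hk0 : 0 < k := hl.trans_le hlk
  have hms : ∀ j : ℝ, MeasurableSet {x | j < u x} := fun j => measurableSet_lt measurable_const hu
  have hsub : ∀ j : ℝ, 0 < j → {x | j < u x} ⊆ Ω := fun j hj x hx => by
    by_contra h
    have : j < u x := hx
    rw [hu0 x h] at this
    linarith
  have hpow : ∀ j, 0 ≤ |u j| ^ m j := fun j => Real.rpow_nonneg (abs_nonneg _) _
  have hMl : modLq Ω m u ≤ ENNReal.ofReal (l + l ^ Q) := by
    calc modLq Ω m u ≤ ∫⁻ x in Ω, ENNReal.ofReal (l + l ^ Q) * ENNReal.ofReal (|u x / l| ^ m x) := by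
          refine setLIntegral_mono' hΩ fun x hx => ?_
          rw [← ENNReal.ofReal_mul (by positivity)]
          apply ENNReal.ofReal_le_ofReal
          have e : |u x| = l * |u x / l| := by
            rw [abs_div, abs_of_pos hl, mul_div_cancel₀ _ hl.ne']
          rw [e, Real.mul_rpow hl.le (abs_nonneg _)]
          have hlm : l ^ m x ≤ l + l ^ Q := by
            rcases le_total l 1 with h | h
            · have := Real.rpow_le_rpow_of_exponent_ge hl h (hm x)
              have := Real.rpow_nonneg hl.le Q
              rw [Real.rpow_one] at *
              linarith
            · have := Real.rpow_le_rpow_of_exponent_le h (hmQ x hx)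
              linarith
          gcongr
      _ = ENNReal.ofReal (l + l ^ Q) * modLq Ω m (fun x => u x / l) :=
          lintegral_const_mul' _ _ ENNReal.ofReal_ne_top
      _ ≤ ENNReal.ofReal (l + l ^ Q) * 1 := by gcongr
      _ = _ := mul_one _
  have hvol : ∀ j, k ≤ j → volume {x | j < u x} ≤ ENNReal.ofReal (l / k) := by
    intro j hj
    have hjl : 1 ≤ k / l := (one_le_div hl).2 hlk
    have := volume_le_of_le_rpow (hms j) (hsub j (hk0.trans_le hj)) (u := fun x => u x / l) (e := m)
      (a := k / l) (b := 1) (by positivity) (fun x hx => ?_) (by simpa using hmod)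
    · rwa [one_div_div] at this
    · have h1 : k ≤ u x := hj.trans (le_of_lt hx)
      have h2 : k / l ≤ |u x / l| := le_trans (by gcongr) (le_abs_self _)
      exact h2.trans (Real.self_le_rpow_of_one_le (hjl.trans h2) (hm x))
  have hZle : ∀ j, superlevelMod Ω m u j ≤ volume (Ω ∩ {x | j < u x}) + modLq Ω m u := by
    intro j
    have : ∀ x, ENNReal.ofReal (1 + |u x| ^ m x) = 1 + ENNReal.ofReal (|u x| ^ m x) := fun x => by
      rw [ENNReal.ofReal_add zero_le_one (hpow x), ENNReal.ofReal_one]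
    unfold superlevelMod
    simp only [this]
    rw [lintegral_add_left measurable_const, setLIntegral_one]
    gcongr
    exact lintegral_mono_set inter_subset_left
  have hfin : ∀ j, superlevelMod Ω m u j ≠ ⊤ := fun j => ((hZle j).trans_lt (ENNReal.add_lt_top.2
    ⟨(measure_mono inter_subset_left).trans_lt hΩb.measure_lt_top,
      hMl.trans_lt ENNReal.ofReal_lt_top⟩)).ne
  have hVZ : ∀ j, volume (Ω ∩ {x | j < u x}) ≤ superlevelMod Ω m u j := by
    intro j
    rw [← setLIntegral_one]
    refine lintegral_mono fun x => ?_
    rw [← ENNReal.ofReal_one]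
    exact ENNReal.ofReal_le_ofReal (by linarith [hpow x])
  have hanti : Antitone fun j => (superlevelMod Ω m u j).toReal := fun i j hij =>
    ENNReal.toReal_mono (hfin i) (lintegral_mono_set
      (inter_subset_inter_right _ fun x hx => lt_of_le_of_lt hij hx))
  have hzero := hdg (fun j => (superlevelMod Ω m u j).toReal) k hk0
    (fun _ => ENNReal.toReal_nonneg) hanti ?_ (hinit _ ENNReal.toReal_nonneg ?_)
  · have h2k : superlevelMod Ω m u (2 * k) = 0 :=
      ((ENNReal.toReal_eq_zero_iff _).1 hzero).resolve_right (hfin _)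
    have := hVZ (2 * k)
    rw [h2k, inter_eq_right.2 (hsub (2 * k) (by linarith))] at this
    exact le_antisymm this bot_le
  · intro j h hj hh
    have hj0 : 0 < j := hk0.trans_le hj
    have hZ0 : 0 ≤ (superlevelMod Ω m u j).toReal := ENNReal.toReal_nonneg
    have hD : ENNReal.ofReal (C₁ * (superlevelMod Ω m u j).toReal) =
        ENNReal.ofReal C₁ * superlevelMod Ω m u j := by
      rw [ENNReal.ofReal_mul hC₁0.le, ENNReal.ofReal_toReal (hfin j)]
    have hvD : volume {x | j < u x} ≤ ENNReal.ofReal (C₁ * (superlevelMod Ω m u j).toReal) := by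
      have := hVZ j
      rw [inter_eq_right.2 (hsub j hj0)] at this
      rw [hD]
      refine this.trans (le_mul_of_one_le_left bot_le ?_)
      rw [← ENNReal.ofReal_one]
      exact ENNReal.ofReal_le_ofReal hC₁
    have := hrec u hu j h (C₁ * (superlevelMod Ω m u j).toReal) hj0 hh
      ((hvol j hj).trans (ENNReal.ofReal_le_ofReal hlkc)) (by positivity) hvD
      ((hgag j hj0).trans hD.ge)
    refine (ENNReal.toReal_le_of_le_ofReal (Finset.sum_nonneg fun i hi => by positivity)
      this).trans (Finset.sum_le_sum fun i hi => ?_)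
    rw [Real.mul_rpow hC₁0.le hZ0]
    calc _ = C * C₁ ^ (1 + δ i) * (1 + j / h) ^ Q * (1 + h ^ (-Q)) * h ^ (-β i) *
          (superlevelMod Ω m u j).toReal ^ (1 + δ i) := by ring
      _ ≤ _ := by
          have := hsum i hi
          gcongr
  · refine ENNReal.toReal_le_of_le_ofReal (by positivity) ((hZle k).trans ?_)
    rw [ENNReal.ofReal_add (by positivity) (by positivity)]
    exact add_le_add ((measure_mono inter_subset_right).trans (hvol k le_rfl)) hMl

lemma IsWeakSolution.neg {N : ℕ} {Ω : Set (EuclideanSpace ℝ (Fin N))} {s : ℝ}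
    {p : EuclideanSpace ℝ (Fin N) → EuclideanSpace ℝ (Fin N) → ℝ}
    {f : EuclideanSpace ℝ (Fin N) → ℝ → ℝ} {u : EuclideanSpace ℝ (Fin N) → ℝ}
    (hu : IsWeakSolution Ω s p f u) :
    IsWeakSolution Ω s p (fun x t => -f x (-t)) fun x => -u x := by
  refine ⟨hu.1.neg, fun v hv => ?_⟩
  have h := congrArg Neg.neg (hu.2 v hv)
  have e1 : ∀ x y, |-u x - -u y| = |u x - u y| := fun x y => by
    rw [← abs_neg (u x - u y)]; ring_nf
  have e2 : ∀ x y, |u x - u y| ^ (p x y - 2) * (-u x - -u y) * (v x - v y) /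
      ‖x - y‖ ^ ((N : ℝ) + s * p x y) = -(|u x - u y| ^ (p x y - 2) * (u x - u y) * (v x - v y) /
      ‖x - y‖ ^ ((N : ℝ) + s * p x y)) := fun x y => by ring
  simpa only [e1, e2, neg_neg, neg_mul, integral_neg] using h

/-- A bound that is continuous in the level passes to the Luxemburg norm. -/
lemma le_of_forall_luxNorm_level {N : ℕ} {Ω : Set (EuclideanSpace ℝ (Fin N))}
    {m u : EuclideanSpace ℝ (Fin N) → ℝ} (hm : ∀ x, 1 ≤ m x) (hfin : modLq Ω m u < ⊤)
    {g : ℝ → ℝ} (hg : Continuous g) {A : ℝ≥0∞}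
    (h : ∀ l, 0 < l → modLq Ω m (fun x => u x / l) ≤ 1 → A ≤ ENNReal.ofReal (g l)) :
    A ≤ ENNReal.ofReal (g (luxNorm Ω m u)) := by
  have hne : {l : ℝ | 0 < l ∧ modLq Ω m (fun x => u x / l) ≤ 1}.Nonempty := by
    set l := max 1 (modLq Ω m u).toReal with hl
    have hl1 : 1 ≤ l := le_max_left _ _
    have hl0 : 0 < l := by linarith
    refine ⟨l, hl0, ?_⟩
    calc modLq Ω m (fun x => u x / l) ≤ ∫⁻ x in Ω, ENNReal.ofReal l⁻¹ *
          ENNReal.ofReal (|u x| ^ m x) := by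
          refine lintegral_mono fun x => ?_
          rw [← ENNReal.ofReal_mul (by positivity)]
          apply ENNReal.ofReal_le_ofReal
          change |u x / l| ^ m x ≤ _
          rw [div_eq_inv_mul, abs_mul, abs_of_pos (inv_pos.2 hl0),
            Real.mul_rpow (by positivity) (abs_nonneg _)]
          have := Real.rpow_le_rpow_of_exponent_ge (inv_pos.2 hl0) (inv_le_one_of_one_le₀ hl1) (hm x)
          rw [Real.rpow_one] at this
          gcongr
      _ = ENNReal.ofReal l⁻¹ * modLq Ω m u := lintegral_const_mul' _ _ ENNReal.ofReal_ne_top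
      _ ≤ ENNReal.ofReal l⁻¹ * ENNReal.ofReal l := by
          gcongr
          rw [← ENNReal.ofReal_toReal hfin.ne]
          exact ENNReal.ofReal_le_ofReal (le_max_right _ _)
      _ = 1 := by
          rw [← ENNReal.ofReal_mul (by positivity), inv_mul_cancel₀ hl0.ne', ENNReal.ofReal_one]
  obtain ⟨w, -, hw, hmem⟩ := exists_seq_tendsto_sInf hne ⟨0, fun l hl => hl.1.le⟩
  exact ge_of_tendsto' (ENNReal.tendsto_ofReal ((hg.tendsto _).comp hw))
    fun n => h _ (hmem n).1 (hmem n).2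

/-- **Theorem 4.2 (global a-priori bound).** Let `Ω ⊂ ℝ^N` (`N ≥ 2`) be a bounded Lipschitz
domain, `s ∈ (0,1)`, `p` continuous symmetric on `ℝ^N × ℝ^N` with `1 < inf p ≤ sup p < N/s`
satisfying the log-Hölder type condition (LH), and let `f` satisfy the growth condition (F1)
with exponent `q`. Then every weak solution `u ∈ W₀^{s,p(·,·)}(Ω)` of
`(−Δ)^s_{p(x)} u = f(x,u)`, `u = 0` on `ℝ^N ∖ Ω`, is in `L^∞(Ω)` and
`‖u‖_{L^∞(Ω)} ≤ C max{‖u‖_{L^{q̃(·)}(Ω)}^{τ₁}, ‖u‖_{L^{q̃(·)}(Ω)}^{τ₂}}` with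
`q̃(x) = max{p(x,x), q(x)}` and `C, τ₁, τ₂` independent of `u`. -/
theorem stmt_4 {N : ℕ} (hN : 2 ≤ N) (Ω : Set (EuclideanSpace ℝ (Fin N)))
    (hΩ : IsLipschitzDomain Ω) (hΩb : Bornology.IsBounded Ω)
    (s : ℝ) (hs0 : 0 < s) (hs1 : s < 1)
    (p : EuclideanSpace ℝ (Fin N) → EuclideanSpace ℝ (Fin N) → ℝ)
    (hp_cont : Continuous
      (fun z : EuclideanSpace ℝ (Fin N) × EuclideanSpace ℝ (Fin N) => p z.1 z.2))
    (hp_symm : ∀ x y, p x y = p y x)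
    (pm pM : ℝ)
    (hpm : pm = sInf (Set.range
      fun z : EuclideanSpace ℝ (Fin N) × EuclideanSpace ℝ (Fin N) => p z.1 z.2))
    (hpM : pM = sSup (Set.range
      fun z : EuclideanSpace ℝ (Fin N) × EuclideanSpace ℝ (Fin N) => p z.1 z.2))
    (hp_lb : 1 < pm)
    (hp_bddAbove : BddAbove (Set.range
      fun z : EuclideanSpace ℝ (Fin N) × EuclideanSpace ℝ (Fin N) => p z.1 z.2))
    (hp_ub : s * pM < N)
    (hLH : LHCondition p)
    (q : EuclideanSpace ℝ (Fin N) → ℝ) (hq_cont : ContinuousOn q (closure Ω))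
    (hq_lb : 1 < sInf (q '' closure Ω)) (hq_bddAbove : BddAbove (q '' closure Ω))
    (hq_sub : ∀ x ∈ closure Ω, q x < N * p x x / (N - s * p x x))
    (f : EuclideanSpace ℝ (Fin N) → ℝ → ℝ)
    (hf_meas : ∀ t : ℝ, Measurable fun x => f x t)
    (hf_cont : ∀ᵐ x ∂(volume.restrict Ω), Continuous fun t => f x t)
    (hf_growth : ∃ C : ℝ, 0 < C ∧ ∀ᵐ x ∂(volume.restrict Ω), ∀ t : ℝ,
      |f x t| ≤ C * (1 + |t| ^ (q x - 1))) :
    ∃ C : ℝ, 0 < C ∧ ∃ τ₁ : ℝ, 0 < τ₁ ∧ ∃ τ₂ : ℝ, 0 < τ₂ ∧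
      ∀ u : EuclideanSpace ℝ (Fin N) → ℝ, IsWeakSolution Ω s p f u →
        eLpNorm u ⊤ (volume.restrict Ω) ≤
          ENNReal.ofReal (C * max (luxNorm Ω (fun x => max (p x x) (q x)) u ^ τ₁)
            (luxNorm Ω (fun x => max (p x x) (q x)) u ^ τ₂)) := by
  have hb : BddBelow (Set.range
      fun z : EuclideanSpace ℝ (Fin N) × EuclideanSpace ℝ (Fin N) => p z.1 z.2) := by
    by_contra h
    rw [Real.sInf_of_not_bddBelow h] at hpm
    linarith
  have hp : ∀ x y, 1 < p x y := fun x y => (hp_lb.trans_eq hpm).trans_le (csInf_le hb ⟨(x, y), rfl⟩)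
  have hpN : ∀ x, s * p x x < N := fun x => by
    have : p x x ≤ pM := hpM ▸ le_csSup hp_bddAbove ⟨(x, x), rfl⟩
    exact lt_of_le_of_lt (by gcongr) hp_ub
  have hqb : BddBelow (q '' closure Ω) := by
    by_contra h
    rw [Real.sInf_of_not_bddBelow h] at hq_lb
    linarith
  have hq : ∀ x ∈ Ω, 1 ≤ q x := fun x hx =>
    (hq_lb.trans_le (csInf_le hqb ⟨x, subset_closure hx, rfl⟩)).le
  have hΩm : MeasurableSet Ω := hΩ.1.measurableSet
  set m : EuclideanSpace ℝ (Fin N) → ℝ := fun x => max (p x x) (q x) with hm_def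
  have hm : ∀ x, 1 ≤ m x := fun x => (hp x x).le.trans (le_max_left _ _)
  obtain ⟨Cf, hCf, hf⟩ := hf_growth
  obtain ⟨t, β, δ, C, Q, c, hβ, hδ, hC, hQ, hc, hmQ, hrec⟩ :=
    exists_superlevel_recursion (by omega) hΩm hΩb hs0 hp_cont hp hpN hq_cont hq_sub
  obtain ⟨K, a, b, hK, ha, hb, hbound⟩ :=
    exists_sup_bound hΩm hΩb hm hmQ hβ hδ hC hQ hc (le_max_right (2 * Cf) 1) hrec
  have hside : ∀ (g : EuclideanSpace ℝ (Fin N) → ℝ → ℝ) (v : EuclideanSpace ℝ (Fin N) → ℝ),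
      (∀ᵐ x ∂(volume.restrict Ω), ∀ t : ℝ, |g x t| ≤ Cf * (1 + |t| ^ (q x - 1))) →
      IsWeakSolution Ω s p g v → ∀ l, 0 < l → modLq Ω m (fun x => v x / l) ≤ 1 →
      volume {x | 2 * (K * max (l ^ a) (l ^ b)) < v x} = 0 := fun g v hg hv =>
    hbound v hv.1.1 hv.1.2.2.2 fun k hk =>
      (gagMod_truncation_le hΩm hp_cont hp hq hCf hg hv hk).trans
        (mul_le_mul_left (ENNReal.ofReal_le_ofReal (le_max_left _ _)) _)
  refine ⟨2 * K, by positivity, a, ha, b, hb, fun u hu => ?_⟩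
  refine le_of_forall_luxNorm_level (g := fun l => 2 * K * max (l ^ a) (l ^ b)) hm
    (modLq_lt_top_of_memW0 hΩm hΩb hp hm hmQ hc hrec hu.1)
    (((Real.continuous_rpow_const ha.le).max (Real.continuous_rpow_const hb.le)).const_mul _)
    fun l hl hmod => ?_
  have h1 := hside f u hf hu l hl hmod
  have h2 := hside (fun x t => -f x (-t)) (fun x => -u x)
    (hf.mono fun x hx t => by simpa only [abs_neg] using hx (-t)) hu.neg l hl
    (by simpa only [modLq, neg_div, abs_neg] using hmod)
  rw [eLpNorm_exponent_top]
  refine eLpNormEssSup_le_of_ae_bound (ae_restrict_of_ae ?_)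
  filter_upwards [measure_eq_zero_iff_ae_notMem.1 h1, measure_eq_zero_iff_ae_notMem.1 h2]
    with x hx1 hx2
  rw [mul_assoc, Real.norm_eq_abs]
  exact abs_le'.2 ⟨not_lt.1 hx1, not_lt.1 hx2⟩
end
end

section
/- Let {Z_n}_{n=0}^∞ be a sequence of positive real numbers satisfying Z_{n+1} ≤ K b^n (Z_n^{1+δ₁} + Z_n^{1+δ₂}) for all n ≥ 0, where b > 1, K > 0 and δ₂ ≥ δ₁ > 0. If Z₀ ≤ min(1, (2K)^{−1/δ₁} b^{−1/δ₁²}) or Z₀ ≤ min((2K)^{−1/δ₁} b^{−1/δ₁²}, (2K)^{−1/δ₂} b^{−1/(δ₁δ₂) − (δ₂−δ₁)/δ₂²}), then there exists n ∈ ℕ₀ with Z_n ≤ 1, and, with n₀ the smallest such index, Z_n ≤ min(1, (2K)^{−1/δ₁} b^{−1/δ₁²} b^{−n/δ₁}) for all n ≥ n₀; in particular Z_n → 0 as n → ∞. -/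
open Filter

/-- If `M` satisfies the smallness condition for the exponent `δ` and that exponent dominates both
powers of `z`, one step of the recursion contracts by the factor `b ^ (-1 / δ₁)`. -/
lemma recursion_step_le {z M K b δ δ₁ δ₂ : ℝ} {n : ℕ} (hz : 0 < z) (hM : 0 < M) (hb : 1 < b)
    (hK : 0 < K) (hδ₁ : 0 < δ₁) (hδ : δ₁ ≤ δ) (hzM : z ≤ M * b ^ (-(n : ℝ) / δ₁))
    (hMK : 2 * K * M ^ δ ≤ b ^ (-1 / δ₁)) (h₁ : z ^ δ₁ ≤ z ^ δ) (h₂ : z ^ δ₂ ≤ z ^ δ) :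
    K * b ^ (n : ℝ) * (z ^ (1 + δ₁) + z ^ (1 + δ₂)) ≤ z * b ^ (-1 / δ₁) := by
  have hb0 : 0 < b := by linarith
  have hpow : z ^ δ ≤ M ^ δ * b ^ (-(n : ℝ)) := by
    calc z ^ δ ≤ (M * b ^ (-(n : ℝ) / δ₁)) ^ δ :=
          Real.rpow_le_rpow hz.le hzM (by linarith)
      _ = M ^ δ * b ^ (-(n : ℝ) / δ₁ * δ) := by
          rw [Real.mul_rpow hM.le (by positivity), ← Real.rpow_mul hb0.le]
      _ ≤ M ^ δ * b ^ (-(n : ℝ)) := by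
          gcongr
          · exact hb.le
          · rw [div_mul_eq_mul_div, div_le_iff₀ hδ₁]
            nlinarith [(Nat.cast_nonneg n : (0 : ℝ) ≤ n)]
  have hcancel : b ^ (n : ℝ) * b ^ (-(n : ℝ)) = 1 := by
    rw [← Real.rpow_add hb0]; simp
  rw [Real.rpow_add hz, Real.rpow_add hz, Real.rpow_one]
  calc K * b ^ (n : ℝ) * (z * z ^ δ₁ + z * z ^ δ₂)
      ≤ K * b ^ (n : ℝ) * (z * (M ^ δ * b ^ (-(n : ℝ))) + z * (M ^ δ * b ^ (-(n : ℝ)))) := by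
        have := h₁.trans hpow
        have := h₂.trans hpow
        gcongr
    _ = z * (2 * K * M ^ δ) * (b ^ (n : ℝ) * b ^ (-(n : ℝ))) := by ring
    _ ≤ z * b ^ (-1 / δ₁) := by
        rw [hcancel, mul_one]
        gcongr

lemma mul_rpow_neg_inv_mul_rpow {c b δ e : ℝ} (hc : 0 < c) (hb : 0 < b) (hδ : 0 < δ) :
    c * (c ^ (-1 / δ) * b ^ e) ^ δ = b ^ (e * δ) := by
  rw [Real.mul_rpow (by positivity) (by positivity), ← Real.rpow_mul hc.le,
    ← Real.rpow_mul hb.le, div_mul_cancel₀ _ hδ.ne', Real.rpow_neg_one, ← mul_assoc,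
    mul_inv_cancel₀ hc.ne', one_mul]

/-- **De Giorgi type recursion lemma** (Lemma 4.3 of Ho–Sim, as used in the paper).
If a sequence of positive numbers satisfies the recursion inequality
`Z_{n+1} ≤ K bⁿ (Z_n^{1+δ₁} + Z_n^{1+δ₂})` and `Z₀` is small enough, then some `Z_{n₀} ≤ 1`,
the tail decays geometrically and `Z_n → 0`. -/
theorem stmt_9 (Z : ℕ → ℝ) (hZpos : ∀ n, 0 < Z n)
    (K b δ₁ δ₂ : ℝ) (hb : 1 < b) (hK : 0 < K) (hδ₁ : 0 < δ₁) (hδ : δ₁ ≤ δ₂)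
    (hrec : ∀ n : ℕ, Z (n + 1) ≤ K * b ^ (n : ℝ) * (Z n ^ (1 + δ₁) + Z n ^ (1 + δ₂)))
    (hZ0 : Z 0 ≤ min 1 ((2 * K) ^ (-1 / δ₁) * b ^ (-1 / δ₁ ^ 2)) ∨
      Z 0 ≤ min ((2 * K) ^ (-1 / δ₁) * b ^ (-1 / δ₁ ^ 2))
        ((2 * K) ^ (-1 / δ₂) * b ^ (-1 / (δ₁ * δ₂) - (δ₂ - δ₁) / δ₂ ^ 2))) :
    (∃ n : ℕ, Z n ≤ 1) ∧
    (∀ n₀ : ℕ, (Z n₀ ≤ 1 ∧ ∀ m : ℕ, m < n₀ → 1 < Z m) →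
      ∀ n : ℕ, n₀ ≤ n →
        Z n ≤ min 1 ((2 * K) ^ (-1 / δ₁) * b ^ (-1 / δ₁ ^ 2) * b ^ (-(n : ℝ) / δ₁))) ∧
    Tendsto Z atTop (nhds 0) := by
  have hb0 : 0 < b := by linarith
  have hδ₂ : 0 < δ₂ := by linarith
  have hratio : b ^ (-1 / δ₁) < 1 :=
    Real.rpow_lt_one_of_one_lt_of_neg hb (div_neg_of_neg_of_pos (by norm_num) hδ₁)
  have hratio0 : 0 < b ^ (-1 / δ₁) := by positivity
  have hsplit (n : ℕ) : b ^ (-(n : ℝ) / δ₁) = (b ^ (-1 / δ₁)) ^ n := by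
    rw [← Real.rpow_natCast, ← Real.rpow_mul hb0.le]
    congr 1
    ring
  set A : ℝ := (2 * K) ^ (-1 / δ₁) * b ^ (-1 / δ₁ ^ 2) with hA
  set B : ℝ := (2 * K) ^ (-1 / δ₂) * b ^ (-1 / (δ₁ * δ₂) - (δ₂ - δ₁) / δ₂ ^ 2) with hB
  have hApos : 0 < A := by positivity
  have hBpos : 0 < B := by positivity
  have hAK : 2 * K * A ^ δ₁ ≤ b ^ (-1 / δ₁) := by
    rw [hA, mul_rpow_neg_inv_mul_rpow (by positivity) hb0 hδ₁]
    apply le_of_eq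
    congr 1
    field_simp
  have hBK : 2 * K * B ^ δ₂ ≤ b ^ (-1 / δ₁) := by
    rw [hB, mul_rpow_neg_inv_mul_rpow (by positivity) hb0 hδ₂]
    apply Real.rpow_le_rpow_of_exponent_le hb.le
    have h : (-1 / (δ₁ * δ₂) - (δ₂ - δ₁) / δ₂ ^ 2) * δ₂ = -1 / δ₁ - (δ₂ - δ₁) / δ₂ := by
      field_simp
    have : 0 ≤ (δ₂ - δ₁) / δ₂ := div_nonneg (by linarith) hδ₂.le
    linarith
  have hZA : Z 0 ≤ A := by
    rcases hZ0 with h | h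
    · exact h.trans (min_le_right _ _)
    · exact h.trans (min_le_left _ _)
  have hZB : Z 0 ≤ 1 ∨ Z 0 ≤ B := by
    rcases hZ0 with h | h
    · exact Or.inl (h.trans (min_le_left _ _))
    · exact Or.inr (h.trans (min_le_right _ _))
  have hstep (n : ℕ) (hn : Z n ≤ Z 0 * b ^ (-(n : ℝ) / δ₁)) :
      Z (n + 1) ≤ Z n * b ^ (-1 / δ₁) := by
    refine (hrec n).trans ?_
    rcases le_or_gt (Z n) 1 with h1 | h1
    · exact recursion_step_le (hZpos n) hApos hb hK hδ₁ le_rfl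
        (hn.trans (by gcongr)) hAK le_rfl
        (Real.rpow_le_rpow_of_exponent_ge (hZpos n) h1 hδ)
    · have hZ0' : Z 0 ≤ B := by
        refine hZB.resolve_left fun h => ?_
        have : b ^ (-(n : ℝ) / δ₁) ≤ 1 := by
          rw [hsplit]
          exact pow_le_one₀ hratio0.le hratio.le
        nlinarith [hZpos 0]
      exact recursion_step_le (hZpos n) hBpos hb hK hδ₁ hδ
        (hn.trans (by gcongr)) hBK
        (Real.rpow_le_rpow_of_exponent_le h1.le hδ) le_rfl
  have hdecay (n : ℕ) : Z n ≤ Z 0 * b ^ (-(n : ℝ) / δ₁) := by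
    induction n with
    | zero => simp
    | succ k ih =>
      refine (hstep k ih).trans ?_
      rw [hsplit] at ih ⊢
      rw [pow_succ, ← mul_assoc]
      gcongr
  have hanti : Antitone Z := antitone_nat_of_succ_le fun n =>
    (hstep n (hdecay n)).trans (mul_le_of_le_one_right (hZpos n).le hratio.le)
  have hlim : Tendsto Z atTop (nhds 0) := by
    refine squeeze_zero (fun n => (hZpos n).le) (fun n => (hdecay n).trans_eq (by rw [hsplit])) ?_
    simpa using (tendsto_pow_atTop_nhds_zero_of_lt_one hratio0.le hratio).const_mul (Z 0)
  refine ⟨(hlim.eventually_le_const one_pos).exists, fun n₀ h n hn => le_min ?_ ?_, hlim⟩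
  · exact (hanti hn).trans h.1
  · exact (hdecay n).trans (by gcongr)
end

section
/- Let Ω ⊂ ℝ^N be a bounded domain, let R > 0 with Ω̄×Ω̄ ⊂ B_R((0,0)) ⊂ ℝ^{2N}, let ξ_R ∈ C_c^∞(ℝ^N×ℝ^N) satisfy 0 ≤ ξ_R ≤ 1, ξ_R = 1 on Ω̄×Ω̄, and supp ξ_R ⊂ B_R((0,0)), and let p₀ > 1 be a constant. Define p(x,y) := p₀ + |x−y| ξ_R(x,y) on ℝ^N×ℝ^N. Then 1 < p₀ ≤ p(x,y) ≤ p₀ + sup_{(x,y)∈B_R((0,0))} |x−y| ξ_R(x,y) < ∞, and p satisfies the log-Hölder type condition (LH): inf_{ε>0} sup{ |p(x,y) − inf_{B_ε((x,y))} p| · log(1/|x−y|) : x,y ∈ ℝ^N, 0 < |x−y| < 1/2 } < ∞. -/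
open MeasureTheory Metric Set
open scoped ENNReal NNReal

/-- **Example 4.3:** for a bounded domain `Ω`, a radius `R` with `Ω̄ × Ω̄ ⊂ B_R((0,0))`, a cut-off
`ξ_R ∈ C_c^∞(ℝ^N × ℝ^N)` with `0 ≤ ξ_R ≤ 1`, `ξ_R = 1` on `Ω̄ × Ω̄`, `supp ξ_R ⊂ B_R((0,0))`,
and a constant `p₀ > 1`, the exponent `p(x,y) = p₀ + |x−y| ξ_R(x,y)` satisfies
`1 < p₀ ≤ p(x,y) ≤ p₀ + sup_{B_R((0,0))} |x−y| ξ_R(x,y) < ∞` and the log-Hölder type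
condition (LH). -/
theorem stmt_12 {N : ℕ} (Ω : Set (EuclideanSpace ℝ (Fin N)))
    (hΩo : IsOpen Ω) (hΩconn : IsConnected Ω) (hΩb : Bornology.IsBounded Ω)
    (R : ℝ) (hR : 0 < R)
    (hΩR : (closure Ω) ×ˢ (closure Ω) ⊆
      Metric.ball ((0, 0) : EuclideanSpace ℝ (Fin N) × EuclideanSpace ℝ (Fin N)) R)
    (ξR : EuclideanSpace ℝ (Fin N) × EuclideanSpace ℝ (Fin N) → ℝ)
    (hξ_smooth : ContDiff ℝ (⊤ : ℕ∞) ξR) (hξ_cpt : HasCompactSupport ξR)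
    (hξ01 : ∀ z, 0 ≤ ξR z ∧ ξR z ≤ 1)
    (hξ1 : ∀ z ∈ (closure Ω) ×ˢ (closure Ω), ξR z = 1)
    (hξ_supp : tsupport ξR ⊆
      Metric.ball ((0, 0) : EuclideanSpace ℝ (Fin N) × EuclideanSpace ℝ (Fin N)) R)
    (p₀ : ℝ) (hp₀ : 1 < p₀)
    (p : EuclideanSpace ℝ (Fin N) → EuclideanSpace ℝ (Fin N) → ℝ)
    (hp_def : ∀ x y, p x y = p₀ + ‖x - y‖ * ξR (x, y)) :
    (∀ x y, p₀ ≤ p x y) ∧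
    (∀ x y, p x y ≤ p₀ +
      sSup ((fun z : EuclideanSpace ℝ (Fin N) × EuclideanSpace ℝ (Fin N) =>
        ‖z.1 - z.2‖ * ξR z) ''
        Metric.ball ((0, 0) : EuclideanSpace ℝ (Fin N) × EuclideanSpace ℝ (Fin N)) R)) ∧
    LHCondition p := by
  have hp_ge : ∀ x y, p₀ ≤ p x y := fun x y => by
    rw [hp_def]
    exact le_add_of_nonneg_right (mul_nonneg (norm_nonneg _) (hξ01 _).1)
  refine ⟨hp_ge, fun x y => ?_, 1, 1, one_pos, fun x y hpos hlt => ?_⟩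
  · rw [hp_def, add_le_add_iff_left]
    by_cases hz : (x, y) ∈ Metric.ball
        ((0, 0) : EuclideanSpace ℝ (Fin N) × EuclideanSpace ℝ (Fin N)) R
    · refine le_csSup ⟨R + R, ?_⟩ ⟨(x, y), hz, rfl⟩
      rintro _ ⟨z, hz, rfl⟩
      have hzR : ‖z‖ < R := mem_ball_zero_iff.1 hz
      have hsub : ‖z.1 - z.2‖ ≤ R + R :=
        (norm_sub_le _ _).trans (add_le_add ((norm_fst_le z).trans hzR.le)
          ((norm_snd_le z).trans hzR.le))
      exact (mul_le_of_le_one_right (norm_nonneg _) (hξ01 z).2).trans hsub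
    · rw [image_eq_zero_of_notMem_tsupport fun h => hz (hξ_supp h), mul_zero]
      refine Real.sSup_nonneg ?_
      rintro _ ⟨z, -, rfl⟩
      exact mul_nonneg (norm_nonneg _) (hξ01 z).1
  · have hmem : p x y ∈
        (fun z : EuclideanSpace ℝ (Fin N) × EuclideanSpace ℝ (Fin N) => p z.1 z.2) ''
          Metric.ball ((x, y) : EuclideanSpace ℝ (Fin N) × EuclideanSpace ℝ (Fin N)) 1 :=
      ⟨(x, y), Metric.mem_ball_self one_pos, rfl⟩
    have hlower : p₀ ∈ lowerBounds
        ((fun z : EuclideanSpace ℝ (Fin N) × EuclideanSpace ℝ (Fin N) => p z.1 z.2) ''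
          Metric.ball ((x, y) : EuclideanSpace ℝ (Fin N) × EuclideanSpace ℝ (Fin N)) 1) := by
      rintro _ ⟨z, -, rfl⟩
      exact hp_ge _ _
    have hinf_le := csInf_le ⟨p₀, hlower⟩ hmem
    have hle_inf := le_csInf ⟨_, hmem⟩ hlower
    have hp_le : p x y ≤ p₀ + ‖x - y‖ := by
      rw [hp_def, add_le_add_iff_left]
      exact mul_le_of_le_one_right hpos.le (hξ01 _).2
    have hlog_nonneg : 0 ≤ Real.log (1 / ‖x - y‖) :=
      Real.log_nonneg ((one_le_div hpos).2 (by linarith))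
    have hlog_le := Real.log_le_sub_one_of_pos (one_div_pos.2 hpos)
    rw [abs_of_nonneg (sub_nonneg.2 hinf_le)]
    calc _ ≤ ‖x - y‖ * Real.log (1 / ‖x - y‖) :=
          mul_le_mul_of_nonneg_right (by linarith) hlog_nonneg
      _ ≤ ‖x - y‖ * (1 / ‖x - y‖ - 1) := mul_le_mul_of_nonneg_left hlog_le hpos.le
      _ = 1 - ‖x - y‖ := by field_simp
      _ ≤ 1 := by linarith
end

section
/- Let Ω ⊂ ℝ^N be a bounded domain with Ω − Ω ⊂ B_{R−1}(0) for some R > 1, let s ∈ (0,1), let p be a continuous symmetric function on ℝ^N×ℝ^N with 1 < p⁻ := inf p ≤ p⁺ := sup p < ∞, let B ⊂ ℝ^N be an open ball, and set p_B⁻ := inf_{(x,y)∈B×B} p(x,y). Assume there is C₅ ∈ (0,1] with |x−y|^{s(p(x,y) − p_B⁻)} ≥ C₅ for all x,y ∈ B, x ≠ y. Let A ⊆ Ω be measurable and let v: ℝ^N → [0,∞) be measurable with v = 0 outside A. Then ∫_B∫_B |v(x)−v(y)|^{p_B⁻} / |x−y|^{N+s p_B⁻} dx dy ≤ (1/C₅)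 ∫_B∫_B |v(x)−v(y)|^{p(x,y)} / |x−y|^{N+s p(x,y)} dx dy + 3 (ω_N R^{s p⁺} / (s p⁻)) |A|, where ω_N is the area of the unit sphere in ℝ^N and |A| is the Lebesgue measure of A. -/
open MeasureTheory Metric Set
open scoped ENNReal NNReal

theorem pow_sub_one_mul_rpow_sub {n : ℕ} (hn : 0 < n) {t : ℝ} (ht : 0 < t) (α : ℝ) :
    t ^ (n - 1) * t ^ (α - n) = t ^ (α - 1) := by
  rw [← Real.rpow_natCast, ← Real.rpow_add ht, Nat.cast_pred hn]
  congr 1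
  ring

section Radial

variable {E : Type*} [NormedAddCommGroup E] [NormedSpace ℝ E] [Nontrivial E]
  [MeasurableSpace E] [BorelSpace E] [FiniteDimensional ℝ E]

/-- Polar coordinates for the lower integral of a nonnegative radial function. -/
theorem lintegral_ofReal_fun_norm_addHaar (μ : Measure E) [μ.IsAddHaarMeasure]
    {f : ℝ → ℝ} (hf : ∀ t, 0 ≤ t → 0 ≤ f t)
    (hint : IntegrableOn (fun t : ℝ ↦ t ^ (Module.finrank ℝ E - 1) • f t) (Ioi 0)) :
    ∫⁻ x, ENNReal.ofReal (f ‖x‖) ∂μ = ENNReal.ofReal ((Module.finrank ℝ E * μ.real (ball 0 1)) *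
      ∫ t in Ioi (0 : ℝ), t ^ (Module.finrank ℝ E - 1) • f t) := by
  rw [← ofReal_integral_eq_lintegral_ofReal ((integrable_fun_norm_addHaar μ).2 hint)
    (.of_forall fun x ↦ hf _ (norm_nonneg x)), integral_fun_norm_addHaar μ f, nsmul_eq_mul,
    smul_eq_mul, mul_assoc]

theorem lintegral_norm_rpow_near_zero (μ : Measure E) [μ.IsAddHaarMeasure]
    {α r : ℝ} (hα : 0 < α) (hr : 0 < r) :
    ∫⁻ x, ENNReal.ofReal ((Iio r).indicator (fun t ↦ t ^ (α - Module.finrank ℝ E)) ‖x‖) ∂μ =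
      ENNReal.ofReal ((Module.finrank ℝ E * μ.real (ball (0 : E) 1)) * (r ^ α / α)) := by
  have heq : EqOn (fun t : ℝ ↦ t ^ (Module.finrank ℝ E - 1) •
      (Iio r).indicator (fun t ↦ t ^ (α - Module.finrank ℝ E)) t)
      ((Iio r).indicator (fun t ↦ t ^ (α - 1))) (Ioi 0) := by
    intro t ht
    by_cases h : t < r
    · simp [h, pow_sub_one_mul_rpow_sub (Module.finrank_pos (R := ℝ) (M := E)) ht]
    · simp [h]
  have hset : Ioi (0 : ℝ) ∩ Iio r = Ioo 0 r := Ioi_inter_Iio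
  have hint : IntegrableOn (fun t : ℝ ↦ t ^ (α - 1)) (Ioo 0 r) :=
    (intervalIntegral.integrableOn_Ioo_rpow_iff hr).2 (by linarith)
  rw [lintegral_ofReal_fun_norm_addHaar μ
    (f := (Iio r).indicator fun t ↦ t ^ (α - Module.finrank ℝ E))
    (fun t ht ↦ indicator_apply_nonneg fun _ ↦ Real.rpow_nonneg ht _),
    setIntegral_congr_fun measurableSet_Ioi heq, setIntegral_indicator measurableSet_Iio, hset,
    ← integral_Ioc_eq_integral_Ioo, ← intervalIntegral.integral_of_le hr.le,
    integral_rpow (Or.inl (by linarith))]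
  · simp [Real.zero_rpow hα.ne']
  · rw [integrableOn_congr_fun heq measurableSet_Ioi, IntegrableOn,
      integrable_indicator_iff measurableSet_Iio, IntegrableOn,
      Measure.restrict_restrict measurableSet_Iio, inter_comm, hset]
    exact hint

theorem lintegral_norm_rpow_away_from_zero (μ : Measure E) [μ.IsAddHaarMeasure]
    {α r : ℝ} (hα : 0 < α) (hr : 0 < r) :
    ∫⁻ x, ENNReal.ofReal ((Ioi r).indicator (fun t ↦ t ^ (-α - Module.finrank ℝ E)) ‖x‖) ∂μ =
      ENNReal.ofReal ((Module.finrank ℝ E * μ.real (ball (0 : E) 1)) * (r ^ (-α) / α)) := by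
  have heq : EqOn (fun t : ℝ ↦ t ^ (Module.finrank ℝ E - 1) •
      (Ioi r).indicator (fun t ↦ t ^ (-α - Module.finrank ℝ E)) t)
      ((Ioi r).indicator (fun t ↦ t ^ (-α - 1))) (Ioi 0) := by
    intro t ht
    by_cases h : r < t
    · simp [h, pow_sub_one_mul_rpow_sub (Module.finrank_pos (R := ℝ) (M := E)) ht]
    · simp [h]
  have hset : Ioi (0 : ℝ) ∩ Ioi r = Ioi r := by
    rw [Ioi_inter_Ioi, sup_eq_right.2 hr.le]
  rw [lintegral_ofReal_fun_norm_addHaar μ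
    (f := (Ioi r).indicator fun t ↦ t ^ (-α - Module.finrank ℝ E))
    (fun t ht ↦ indicator_apply_nonneg fun _ ↦ Real.rpow_nonneg ht _),
    setIntegral_congr_fun measurableSet_Ioi heq, setIntegral_indicator measurableSet_Ioi, hset,
    integral_Ioi_rpow_of_lt (by linarith) hr]
  · rw [sub_add_cancel, neg_div_neg_eq]
  · rw [integrableOn_congr_fun heq measurableSet_Ioi, IntegrableOn,
      integrable_indicator_iff measurableSet_Ioi, IntegrableOn,
      Measure.restrict_restrict measurableSet_Ioi, inter_comm, hset]
    exact integrableOn_Ioi_rpow_of_lt (by linarith) hr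

end Radial

section Pointwise

variable {a d s q r n C : ℝ}

theorem rpow_div_rpow_add_mul (ha : 0 ≤ a) (hd : 0 < d) (n s q : ℝ) :
    a ^ q / d ^ (n + s * q) = (a / d ^ s) ^ q * d ^ (-n) := by
  rw [Real.div_rpow ha (by positivity), ← Real.rpow_mul hd.le, Real.rpow_add hd,
    Real.rpow_neg hd.le]
  field_simp

/-- Lowering the exponent of a fractional difference quotient, at the cost of a kernel that is
integrable near the diagonal. -/
theorem rpow_quotient_le_add_rpow (ha : 0 ≤ a) (hd : 0 < d) (hq : 0 < q) (hqr : q ≤ r)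
    (hC : 0 < C) (hCd : C ≤ d ^ (s * (r - q))) :
    a ^ q / d ^ (n + s * q) ≤ 1 / C * (a ^ r / d ^ (n + s * r)) + d ^ (s * q - n) := by
  rw [rpow_div_rpow_add_mul ha hd, rpow_div_rpow_add_mul ha hd, sub_eq_add_neg, Real.rpow_add hd,
    ← mul_assoc, ← add_mul]
  gcongr
  have hds : 0 < d ^ s := by positivity
  have ht : 0 ≤ a / d ^ s := by positivity
  rcases le_or_gt (a / d ^ s) (d ^ s) with h | h
  · have h1 : (a / d ^ s) ^ q ≤ d ^ (s * q) := by
      rw [Real.rpow_mul hd.le]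
      gcongr
    have h2 : 0 ≤ 1 / C * (a / d ^ s) ^ r := by positivity
    linarith
  · have ht' : 0 < a / d ^ s := hds.trans h
    have h1 : C ≤ (a / d ^ s) ^ (r - q) := hCd.trans (by
      rw [Real.rpow_mul hd.le]
      exact Real.rpow_le_rpow hds.le h.le (by linarith))
    have h2 : (a / d ^ s) ^ q ≤ 1 / C * (a / d ^ s) ^ r := by
      rw [one_div, le_inv_mul_iff₀ hC, ← sub_add_cancel r q, Real.rpow_add ht']
      gcongr
    have h3 : 0 ≤ d ^ (s * q) := by positivity
    linarith

/-- Lowering the exponent of a fractional difference quotient, at the cost of a kernel that is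
integrable away from the diagonal. -/
theorem rpow_quotient_le_add_indicator (ha : 0 ≤ a) (hd : 0 < d) (hs : 0 < s) (hqr : q ≤ r)
    (hC : 0 < C) (hC1 : C ≤ 1) :
    a ^ q / d ^ (n + s * q) ≤ 1 / C * (a ^ r / d ^ (n + s * r)) +
      a ^ q * (Ioi (a ^ s⁻¹)).indicator (fun t ↦ t ^ (-(s * q) - n)) d := by
  by_cases h : a ^ s⁻¹ < d
  · rw [indicator_of_mem (mem_Ioi.2 h), show -(s * q) - n = -(n + s * q) by ring,
      Real.rpow_neg hd.le, ← div_eq_mul_inv]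
    have : 0 ≤ 1 / C * (a ^ r / d ^ (n + s * r)) := by positivity
    linarith
  · rw [indicator_of_notMem (by simpa using h), mul_zero, add_zero, rpow_div_rpow_add_mul ha hd,
      rpow_div_rpow_add_mul ha hd, ← mul_assoc]
    have h1 : d ^ s ≤ a := by
      have := Real.rpow_le_rpow hd.le (not_lt.1 h) hs.le
      rwa [Real.rpow_inv_rpow ha hs.ne'] at this
    have h2 : 1 ≤ a / d ^ s := (one_le_div (by positivity)).2 h1
    have h3 : (a / d ^ s) ^ q ≤ (a / d ^ s) ^ r := Real.rpow_le_rpow_of_exponent_le h2 hqr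
    have h4 : (a / d ^ s) ^ r ≤ 1 / C * (a / d ^ s) ^ r :=
      le_mul_of_one_le_left (by positivity) ((one_le_div hC).2 hC1)
    gcongr
    exact h3.trans h4

end Pointwise

/-- The kernel `t ^ (s * q - n)`, truncated to `t < R`. -/
noncomputable def nearKernel (n s q R t : ℝ) : ℝ≥0∞ :=
  ENNReal.ofReal ((Iio R).indicator (fun t ↦ t ^ (s * q - n)) t)

/-- The kernel `a ^ q * t ^ (-(s * q) - n)`, truncated to `a ^ s⁻¹ < t`. -/
noncomputable def farKernel (n s q a t : ℝ) : ℝ≥0∞ :=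
  ENNReal.ofReal (a ^ q * (Ioi (a ^ s⁻¹)).indicator (fun t ↦ t ^ (-(s * q) - n)) t)

section Kernels

variable {n s q R : ℝ}

@[fun_prop]
theorem measurable_nearKernel : Measurable (nearKernel n s q R) :=
  (Measurable.indicator (by fun_prop) measurableSet_Iio).ennreal_ofReal

theorem measurable_uncurry_farKernel : Measurable (Function.uncurry (farKernel n s q)) := by
  refine (Measurable.mul (by fun_prop) ?_).ennreal_ofReal
  exact Measurable.indicator (f := fun z : ℝ × ℝ ↦ z.2 ^ (-(s * q) - n))
    (s := {z | z.1 ^ s⁻¹ < z.2}) (by fun_prop) (measurableSet_lt (by fun_prop) (by fun_prop))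

@[simp]
theorem farKernel_zero (hq : q ≠ 0) (t : ℝ) : farKernel n s q 0 t = 0 := by
  simp [farKernel, Real.zero_rpow hq]

variable {E : Type*} [NormedAddCommGroup E] [NormedSpace ℝ E] [Nontrivial E]
  [MeasurableSpace E] [BorelSpace E] [FiniteDimensional ℝ E]

theorem lintegral_nearKernel_norm (μ : Measure E) [μ.IsAddHaarMeasure]
    (hsq : 0 < s * q) (hR : 0 < R) :
    ∫⁻ x, nearKernel (Module.finrank ℝ E) s q R ‖x‖ ∂μ =
      ENNReal.ofReal ((Module.finrank ℝ E * μ.real (ball (0 : E) 1)) * (R ^ (s * q) / (s * q))) :=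
  lintegral_norm_rpow_near_zero μ hsq hR

theorem lintegral_farKernel_norm_le (μ : Measure E) [μ.IsAddHaarMeasure]
    (hs : 0 < s) (hq : 0 < q) {a : ℝ} (ha : 0 ≤ a) :
    ∫⁻ x, farKernel (Module.finrank ℝ E) s q a ‖x‖ ∂μ ≤
      ENNReal.ofReal ((Module.finrank ℝ E * μ.real (ball (0 : E) 1)) * (1 / (s * q))) := by
  rcases ha.eq_or_lt with rfl | hpos
  · simp [farKernel_zero hq.ne']
  have haq : 0 ≤ a ^ q := by positivity
  simp only [farKernel, ENNReal.ofReal_mul haq]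
  rw [lintegral_const_mul' _ _ ENNReal.ofReal_ne_top,
    lintegral_norm_rpow_away_from_zero μ (mul_pos hs hq) (Real.rpow_pos_of_pos hpos s⁻¹),
    ← ENNReal.ofReal_mul haq]
  refine ENNReal.ofReal_le_ofReal (le_of_eq ?_)
  have hexp : s⁻¹ * -(s * q) = -q := by field_simp
  rw [← Real.rpow_mul hpos.le, hexp, Real.rpow_neg hpos.le]
  have : a ^ q ≠ 0 := by positivity
  field_simp

end Kernels

/-- If `v` vanishes outside `A` and `A` has diameter less than `R`, lowering the exponent of the
fractional difference quotient of `v` costs one near kernel and two far kernels. -/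
theorem ofReal_rpow_quotient_le_add_kernels {E : Type*} [NormedAddCommGroup E] {A : Set E}
    {v : E → ℝ} {x y : E} {n s q r R C : ℝ} (hv0 : ∀ x, 0 ≤ v x) (hvA : ∀ x, x ∉ A → v x = 0)
    (hAR : ∀ x ∈ A, ∀ y ∈ A, ‖x - y‖ < R) (hs : 0 < s) (hq : 0 < q) (hqr : q ≤ r)
    (hC : 0 < C) (hC1 : C ≤ 1) (hCd : x ≠ y → C ≤ ‖x - y‖ ^ (s * (r - q))) :
    ENNReal.ofReal (|v x - v y| ^ q / ‖x - y‖ ^ (n + s * q)) ≤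
      ENNReal.ofReal (1 / C) * ENNReal.ofReal (|v x - v y| ^ r / ‖x - y‖ ^ (n + s * r)) +
        (A.indicator (fun x ↦ nearKernel n s q R ‖x - y‖) x +
          A.indicator (fun x ↦ farKernel n s q (v x) ‖x - y‖) x +
          A.indicator (fun y ↦ farKernel n s q (v y) ‖y - x‖) y) := by
  rcases eq_or_ne x y with rfl | hxy
  · simp [Real.zero_rpow hq.ne']
  have hd : 0 < ‖x - y‖ := norm_pos_iff.2 (sub_ne_zero.2 hxy)
  rw [← ENNReal.ofReal_mul (by positivity)]
  have hfar := (ENNReal.ofReal_le_ofReal (rpow_quotient_le_add_indicator (n := n)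
    (abs_nonneg (v x - v y)) hd hs hqr hC hC1)).trans ENNReal.ofReal_add_le
  by_cases hxA : x ∈ A
  · by_cases hyA : y ∈ A
    · have hnear := (ENNReal.ofReal_le_ofReal (rpow_quotient_le_add_rpow (n := n)
        (abs_nonneg (v x - v y)) hd hq hqr hC (hCd hxy))).trans ENNReal.ofReal_add_le
      refine hnear.trans (add_le_add le_rfl ?_)
      rw [add_assoc]
      refine le_add_right (le_of_eq ?_)
      simp [nearKernel, hxA, hAR x hxA y hyA]
    · refine hfar.trans (add_le_add le_rfl (le_add_right (le_add_left (le_of_eq ?_))))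
      simp only [indicator_of_mem hxA, farKernel, hvA y hyA, sub_zero, abs_of_nonneg (hv0 x)]
  · refine hfar.trans (add_le_add le_rfl (le_add_left ?_))
    by_cases hyA : y ∈ A
    · simp only [indicator_of_mem hyA, farKernel, hvA x hxA, zero_sub, abs_neg,
        abs_of_nonneg (hv0 y), norm_sub_rev y x, le_refl]
    · simp [hvA x hxA, hvA y hyA, Real.zero_rpow hq.ne']

section DoubleIntegral

variable {E : Type*} [NormedAddCommGroup E] [MeasurableSpace E] [BorelSpace E]
  {A : Set E}

theorem measurable_uncurry_indicator_norm_sub [SecondCountableTopology E] (hA : MeasurableSet A)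
    {κ : E → ℝ → ℝ≥0∞} (hκ : Measurable (Function.uncurry κ)) :
    Measurable (Function.uncurry fun x y ↦ A.indicator (fun x ↦ κ x ‖x - y‖) x) :=
  Measurable.indicator (s := Prod.fst ⁻¹' A) (f := fun z : E × E ↦ κ z.1 ‖z.1 - z.2‖)
    (hκ.comp (f := fun z : E × E ↦ (z.1, ‖z.1 - z.2‖)) (by fun_prop)) (measurable_fst hA)

theorem lintegral_lintegral_indicator_norm_sub_le (μ : Measure E) [μ.IsAddHaarMeasure]
    (hA : MeasurableSet A) {κ : E → ℝ → ℝ≥0∞} {K : ℝ≥0∞} (hK : ∀ x ∈ A, ∫⁻ z, κ x ‖z‖ ∂μ ≤ K) :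
    ∫⁻ x, ∫⁻ y, A.indicator (fun x ↦ κ x ‖x - y‖) x ∂μ ∂μ ≤ K * μ A := by
  rw [← lintegral_indicator_const hA]
  refine lintegral_mono fun x ↦ ?_
  by_cases hx : x ∈ A
  · simp only [indicator_of_mem hx, norm_sub_rev x]
    rw [lintegral_sub_right_eq_self (μ := μ) (fun z ↦ κ x ‖z‖) x]
    exact hK x hx
  · simp [hx]

end DoubleIntegral

theorem lintegral_lintegral_add_add_swap_le {X : Type*} [MeasurableSpace X] (μ : Measure X)
    [SFinite μ] {E₁ E₂ : X → X → ℝ≥0∞} (hE₁ : Measurable (Function.uncurry E₁))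
    (hE₂ : Measurable (Function.uncurry E₂)) {M : ℝ≥0∞} (h₁ : ∫⁻ x, ∫⁻ y, E₁ x y ∂μ ∂μ ≤ M)
    (h₂ : ∫⁻ x, ∫⁻ y, E₂ x y ∂μ ∂μ ≤ M) :
    ∫⁻ x, ∫⁻ y, E₁ x y + E₂ x y + E₂ y x ∂μ ∂μ ≤ 3 * M := by
  have hE₃ : Measurable (Function.uncurry fun x y ↦ E₂ y x) := hE₂.comp measurable_swap
  have h₃ : ∫⁻ x, ∫⁻ y, E₂ y x ∂μ ∂μ ≤ M := by
    rwa [lintegral_lintegral_swap hE₃.aemeasurable]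
  calc ∫⁻ x, ∫⁻ y, E₁ x y + E₂ x y + E₂ y x ∂μ ∂μ
      = (∫⁻ x, ∫⁻ y, E₁ x y ∂μ ∂μ) + (∫⁻ x, ∫⁻ y, E₂ x y ∂μ ∂μ) +
          ∫⁻ x, ∫⁻ y, E₂ y x ∂μ ∂μ := by
        rw [← lintegral_add_left hE₁.lintegral_prod_right,
          ← lintegral_add_right _ hE₃.lintegral_prod_right]
        refine lintegral_congr fun x ↦ ?_
        rw [lintegral_add_right _ (hE₃.of_uncurry_left (x := x)),
          lintegral_add_left (hE₁.of_uncurry_left (x := x))]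
    _ ≤ M + M + M := by gcongr
    _ = 3 * M := by ring

theorem setLIntegral_setLIntegral_le_const_mul_add {X : Type*} [MeasurableSpace X]
    (μ : Measure X) [SFinite μ] {B : Set X} (hB : MeasurableSet B) {F G H : X → X → ℝ≥0∞}
    (hH : Measurable (Function.uncurry H)) {C : ℝ≥0∞} (hC : C ≠ ∞)
    (h : ∀ x ∈ B, ∀ y ∈ B, F x y ≤ C * G x y + H x y) :
    ∫⁻ x in B, ∫⁻ y in B, F x y ∂μ ∂μ ≤
      C * (∫⁻ x in B, ∫⁻ y in B, G x y ∂μ ∂μ) + ∫⁻ x, ∫⁻ y, H x y ∂μ ∂μ := by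
  calc ∫⁻ x in B, ∫⁻ y in B, F x y ∂μ ∂μ
      ≤ ∫⁻ x in B, (C * ∫⁻ y in B, G x y ∂μ) + ∫⁻ y, H x y ∂μ ∂μ := by
        refine setLIntegral_mono' hB fun x hx ↦ ?_
        calc ∫⁻ y in B, F x y ∂μ ≤ ∫⁻ y in B, C * G x y + H x y ∂μ :=
              setLIntegral_mono' hB fun y hy ↦ h x hx y hy
          _ = C * (∫⁻ y in B, G x y ∂μ) + ∫⁻ y in B, H x y ∂μ := by
              rw [lintegral_add_right _ hH.of_uncurry_left, lintegral_const_mul' _ _ hC]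
          _ ≤ _ := by
              gcongr
              exact Measure.restrict_le_self
    _ = C * (∫⁻ x in B, ∫⁻ y in B, G x y ∂μ ∂μ) + ∫⁻ x in B, ∫⁻ y, H x y ∂μ ∂μ := by
        rw [lintegral_add_right _ hH.lintegral_prod_right, lintegral_const_mul' _ _ hC]
    _ ≤ _ := by
        gcongr
        exact Measure.restrict_le_self

/-- **Localization estimate (4.13) (Step 2 of the proof of Theorem 4.2):** for a ball `B`,
`p_B⁻ = inf_{B×B} p`, a constant `C₅ ∈ (0,1]` with `|x−y|^{s(p(x,y)−p_B⁻)} ≥ C₅` on `B × B`,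
a measurable `A ⊆ Ω` and a nonnegative measurable `v` vanishing outside `A`, one has
`∫_B∫_B |v(x)−v(y)|^{p_B⁻}/|x−y|^{N+sp_B⁻}
  ≤ (1/C₅) ∫_B∫_B |v(x)−v(y)|^{p(x,y)}/|x−y|^{N+sp(x,y)} + 3 (ω_N R^{sp⁺}/(sp⁻)) |A|`,
where `ω_N = N·vol(B_1)` is the area of the unit sphere in `ℝ^N`. -/
theorem stmt_16 {N : ℕ} (Ω : Set (EuclideanSpace ℝ (Fin N)))
    (hΩo : IsOpen Ω) (hΩconn : IsConnected Ω) (hΩb : Bornology.IsBounded Ω)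
    (R : ℝ) (hR : 1 < R)
    (hΩR : ∀ x ∈ Ω, ∀ y ∈ Ω, x - y ∈ Metric.ball (0 : EuclideanSpace ℝ (Fin N)) (R - 1))
    (s : ℝ) (hs0 : 0 < s) (hs1 : s < 1)
    (p : EuclideanSpace ℝ (Fin N) → EuclideanSpace ℝ (Fin N) → ℝ)
    (hp_cont : Continuous
      (fun z : EuclideanSpace ℝ (Fin N) × EuclideanSpace ℝ (Fin N) => p z.1 z.2))
    (hp_symm : ∀ x y, p x y = p y x)
    (pm pM : ℝ)
    (hpm : pm = sInf (Set.range
      fun z : EuclideanSpace ℝ (Fin N) × EuclideanSpace ℝ (Fin N) => p z.1 z.2))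
    (hpM : pM = sSup (Set.range
      fun z : EuclideanSpace ℝ (Fin N) × EuclideanSpace ℝ (Fin N) => p z.1 z.2))
    (hp_lb : 1 < pm)
    (hp_bddAbove : BddAbove (Set.range
      fun z : EuclideanSpace ℝ (Fin N) × EuclideanSpace ℝ (Fin N) => p z.1 z.2))
    (c : EuclideanSpace ℝ (Fin N)) (ρ : ℝ) (hρ : 0 < ρ)
    (pB : ℝ)
    (hpB : pB = sInf ((fun z : EuclideanSpace ℝ (Fin N) × EuclideanSpace ℝ (Fin N) => p z.1 z.2)
      '' (Metric.ball c ρ ×ˢ Metric.ball c ρ)))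
    (C₅ : ℝ) (hC₅0 : 0 < C₅) (hC₅1 : C₅ ≤ 1)
    (hC₅ : ∀ x ∈ Metric.ball c ρ, ∀ y ∈ Metric.ball c ρ, x ≠ y →
      C₅ ≤ ‖x - y‖ ^ (s * (p x y - pB)))
    (A : Set (EuclideanSpace ℝ (Fin N))) (hA : MeasurableSet A) (hAΩ : A ⊆ Ω)
    (v : EuclideanSpace ℝ (Fin N) → ℝ) (hv : Measurable v)
    (hv0 : ∀ x, 0 ≤ v x) (hvA : ∀ x, x ∉ A → v x = 0) :
    (∫⁻ x in Metric.ball c ρ, ∫⁻ y in Metric.ball c ρ,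
        ENNReal.ofReal (|v x - v y| ^ pB / ‖x - y‖ ^ ((N : ℝ) + s * pB)))
      ≤ ENNReal.ofReal (1 / C₅) *
          (∫⁻ x in Metric.ball c ρ, ∫⁻ y in Metric.ball c ρ,
            ENNReal.ofReal (|v x - v y| ^ p x y / ‖x - y‖ ^ ((N : ℝ) + s * p x y)))
        + ENNReal.ofReal (3 *
            ((N * (volume (Metric.ball (0 : EuclideanSpace ℝ (Fin N)) 1)).toReal) *
              R ^ (s * pM) / (s * pm))) * volume A := by
  have hbelow : BddBelow (range
      fun z : EuclideanSpace ℝ (Fin N) × EuclideanSpace ℝ (Fin N) ↦ p z.1 z.2) := by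
    by_contra h
    rw [Real.sInf_of_not_bddBelow h] at hpm
    linarith
  have hpmle : ∀ x y, pm ≤ p x y := fun x y ↦ hpm ▸ csInf_le hbelow ⟨(x, y), rfl⟩
  have hpleM : ∀ x y, p x y ≤ pM := fun x y ↦ hpM ▸ le_csSup hp_bddAbove ⟨(x, y), rfl⟩
  have hcB : c ∈ ball c ρ := mem_ball_self hρ
  have hpBle : ∀ x ∈ ball c ρ, ∀ y ∈ ball c ρ, pB ≤ p x y := fun x hx y hy ↦
    hpB ▸ csInf_le (hbelow.mono (image_subset_range _ _)) ⟨(x, y), ⟨hx, hy⟩, rfl⟩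
  have hpmB : pm ≤ pB := by
    rw [hpB]
    refine le_csInf ⟨_, (c, c), ⟨hcB, hcB⟩, rfl⟩ ?_
    rintro _ ⟨z, -, rfl⟩
    exact hpmle _ _
  have hpBM : pB ≤ pM := (hpBle c hcB c hcB).trans (hpleM c c)
  have hpB0 : 0 < pB := by linarith
  rcases subsingleton_or_nontrivial (EuclideanSpace ℝ (Fin N)) with hsub | hnon
  · have h0 : ∀ x y : EuclideanSpace ℝ (Fin N), |v x - v y| ^ pB = 0 := fun x y ↦ by
      rw [Subsingleton.elim x y, sub_self, abs_zero, Real.zero_rpow hpB0.ne']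
    simp [h0]
  set ω : ℝ := N * (volume (ball (0 : EuclideanSpace ℝ (Fin N)) 1)).toReal
  have hω0 : 0 ≤ ω := by positivity
  have hfin : Module.finrank ℝ (EuclideanSpace ℝ (Fin N)) = N := finrank_euclideanSpace_fin
  have hα : 0 < s * pB := by positivity
  have hdiv : ∀ u, 0 ≤ u → u ≤ R ^ (s * pM) → ω * (u / (s * pB)) ≤ ω * R ^ (s * pM) / (s * pm) := by
    intro u hu huR
    rw [mul_div_assoc]
    have : 0 < s * pm := by nlinarith
    gcongr
  have hR1 : 1 ≤ R ^ (s * pM) := Real.one_le_rpow hR.le (by nlinarith)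
  set K : ℝ≥0∞ := ENNReal.ofReal (ω * R ^ (s * pM) / (s * pm)) with hK
  have hnear : ∫⁻ z : EuclideanSpace ℝ (Fin N), nearKernel N s pB R ‖z‖ ≤ K := by
    have := lintegral_nearKernel_norm (E := EuclideanSpace ℝ (Fin N)) volume hα
      (zero_lt_one.trans hR)
    rw [hfin] at this
    refine this.trans_le (ENNReal.ofReal_le_ofReal (hdiv _ (by positivity) ?_))
    exact Real.rpow_le_rpow_of_exponent_le hR.le (by gcongr)
  have hfar : ∀ x, ∫⁻ z : EuclideanSpace ℝ (Fin N), farKernel N s pB (v x) ‖z‖ ≤ K := by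
    intro x
    have := lintegral_farKernel_norm_le (E := EuclideanSpace ℝ (Fin N)) volume hs0 hpB0 (hv0 x)
    rw [hfin] at this
    exact this.trans (ENNReal.ofReal_le_ofReal (hdiv 1 zero_le_one hR1))
  have hE₁ := measurable_uncurry_indicator_norm_sub hA (κ := fun _ ↦ nearKernel N s pB R)
    (measurable_nearKernel.comp measurable_snd)
  have hE₂ := measurable_uncurry_indicator_norm_sub hA (κ := fun x ↦ farKernel N s pB (v x))
    (measurable_uncurry_farKernel.comp (hv.prodMap measurable_id))
  have hI₁ := lintegral_lintegral_indicator_norm_sub_le volume hA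
    (κ := fun _ ↦ nearKernel N s pB R) fun _ _ ↦ hnear
  have hI₂ := lintegral_lintegral_indicator_norm_sub_le volume hA
    (κ := fun x ↦ farKernel N s pB (v x)) fun x _ ↦ hfar x
  have hAR : ∀ x ∈ A, ∀ y ∈ A, ‖x - y‖ < R := fun x hx y hy ↦
    (mem_ball_zero_iff.1 (hΩR x (hAΩ hx) y (hAΩ hy))).trans (by linarith)
  refine (setLIntegral_setLIntegral_le_const_mul_add volume measurableSet_ball
    ((hE₁.add hE₂).add (hE₂.comp measurable_swap)) ENNReal.ofReal_ne_top
    fun x hx y hy ↦ ofReal_rpow_quotient_le_add_kernels hv0 hvA hAR hs0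
      hpB0 (hpBle x hx y hy) hC₅0 hC₅1 (hC₅ x hx y hy)).trans (add_le_add le_rfl ?_)
  rw [mul_div_assoc, ENNReal.ofReal_mul zero_le_three, ← mul_div_assoc, ← hK,
    ENNReal.ofReal_ofNat, mul_assoc]
  exact lintegral_lintegral_add_add_swap_le volume hE₁ hE₂ hI₁ hI₂
end

section
/- Let Ω ⊆ ℝ^N be measurable, p⁻ > 1, 0 < t₂ < t₁/2 ≤ t₀/2, and β ∈ (0,1). Let f: Ω×ℝ → ℝ be Carathéodory with F(x,t) := ∫₀ᵗ f(x,τ) dτ satisfying: F(x,t) ≥ |t|^{p⁻} for a.e. x ∈ Ω and all |t| < t₁, and p⁻ F(x,t) − f(x,t)t > 0 for a.e. x ∈ Ω and all 0 < |t| < t₀. Let ϱ ∈ C¹(ℝ) be even with ϱ(t) = 1 for |t| ≤ t₂, ϱ(t) = 0 for |t| ≥ 2t₂, 0 < ϱ(t) ≤ 1 for |t| < 2t₂, |ϱ'(t)| ≤ 2/t₂, and ϱ'(t)t ≤ 0 for all t. Define F̃(x,t) := ϱ(t)F(x,t) + (1−ϱ(t))β|t|^{p⁻} and f̃(x,t)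 := ∂F̃/∂t(x,t). Then for a.e. x ∈ Ω and all t ∈ ℝ, p⁻ F̃(x,t) − f̃(x,t)t = ϱ(t)[p⁻F(x,t) − f(x,t)t] − ϱ'(t)t[F(x,t) − β|t|^{p⁻}] ≥ 0, and p⁻ F̃(x,t) − f̃(x,t)t = 0 if and only if t = 0 or |t| ≥ 2t₂. -/
open MeasureTheory Metric Set
open scoped ENNReal NNReal

/-- `|t|^(p-2) t · t = |t|^p`, in the form produced by differentiating `|t|^p`. -/
lemma Real.abs_rpow_sub_two_mul_mul_self {p : ℝ} (hp : p ≠ 0) (t : ℝ) :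
    |t| ^ (p - 2) * t * t = |t| ^ p := by
  rcases eq_or_ne t 0 with rfl | ht
  · simp [Real.zero_rpow hp]
  · have h : |t| ^ p = |t| ^ (p - 2) * |t| ^ (2 : ℕ) := by
      rw [← Real.rpow_natCast, ← Real.rpow_add (abs_pos.2 ht)]
      norm_num
    rw [h, sq_abs]
    ring

/-- **Properties (5.4)–(5.5) of the truncated nonlinearity (proof of Theorem 5.1):** with
`F̃(x,t) = ϱ(t)F(x,t) + (1−ϱ(t))β|t|^{p⁻}` and `f̃ = ∂F̃/∂t`, for a.e. `x ∈ Ω` and all `t`,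
`p⁻F̃(x,t) − f̃(x,t)t = ϱ(t)[p⁻F(x,t) − f(x,t)t] − ϱ'(t)t[F(x,t) − β|t|^{p⁻}] ≥ 0`,
with equality iff `t = 0` or `|t| ≥ 2t₂`. -/
theorem stmt_17 {N : ℕ} (Ω : Set (EuclideanSpace ℝ (Fin N))) (hΩ : MeasurableSet Ω)
    (pm : ℝ) (hpm : 1 < pm)
    (t₀ t₁ t₂ : ℝ) (ht₂0 : 0 < t₂) (ht₂ : t₂ < t₁ / 2) (ht₁ : t₁ / 2 ≤ t₀ / 2)
    (β : ℝ) (hβ0 : 0 < β) (hβ1 : β < 1)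
    (f : EuclideanSpace ℝ (Fin N) → ℝ → ℝ)
    (hf_meas : ∀ t : ℝ, Measurable fun x => f x t)
    (hf_cont : ∀ᵐ x ∂(volume.restrict Ω), Continuous fun t => f x t)
    (F : EuclideanSpace ℝ (Fin N) → ℝ → ℝ)
    (hF : ∀ x t, F x t = ∫ τ in (0 : ℝ)..t, f x τ)
    (hF_low : ∀ᵐ x ∂(volume.restrict Ω), ∀ t : ℝ, |t| < t₁ → |t| ^ pm ≤ F x t)
    (hAR : ∀ᵐ x ∂(volume.restrict Ω), ∀ t : ℝ, 0 < |t| → |t| < t₀ →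
      0 < pm * F x t - f x t * t)
    (ϱ : ℝ → ℝ) (hϱC1 : ContDiff ℝ 1 ϱ) (hϱ_even : ∀ t, ϱ (-t) = ϱ t)
    (hϱ_one : ∀ t : ℝ, |t| ≤ t₂ → ϱ t = 1) (hϱ_zero : ∀ t : ℝ, 2 * t₂ ≤ |t| → ϱ t = 0)
    (hϱ_pos : ∀ t : ℝ, |t| < 2 * t₂ → 0 < ϱ t ∧ ϱ t ≤ 1)
    (hϱ_deriv : ∀ t : ℝ, |deriv ϱ t| ≤ 2 / t₂) (hϱ_sign : ∀ t : ℝ, deriv ϱ t * t ≤ 0)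
    (Ft : EuclideanSpace ℝ (Fin N) → ℝ → ℝ)
    (hFt : ∀ x t, Ft x t = ϱ t * F x t + (1 - ϱ t) * β * |t| ^ pm)
    (ft : EuclideanSpace ℝ (Fin N) → ℝ → ℝ)
    (hft : ∀ x t, ft x t = deriv (Ft x) t) :
    ∀ᵐ x ∂(volume.restrict Ω), ∀ t : ℝ,
      (pm * Ft x t - ft x t * t
          = ϱ t * (pm * F x t - f x t * t) - deriv ϱ t * t * (F x t - β * |t| ^ pm)) ∧
      0 ≤ pm * Ft x t - ft x t * t ∧
      (pm * Ft x t - ft x t * t = 0 ↔ t = 0 ∨ 2 * t₂ ≤ |t|) := by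
  have hϱ_nonneg (t : ℝ) : 0 ≤ ϱ t := by
    rcases lt_or_ge |t| (2 * t₂) with h | h
    · exact (hϱ_pos t h).1.le
    · exact (hϱ_zero t h).ge
  filter_upwards [hf_cont, hF_low, hAR] with x hc hlow hx t
  have hFd : HasDerivAt (F x) (f x t) t := by
    rw [funext (hF x)]
    exact intervalIntegral.integral_hasDerivAt_right (hc.intervalIntegrable 0 t)
      hc.stronglyMeasurable.stronglyMeasurableAtFilter hc.continuousAt
  have hϱd : HasDerivAt ϱ (deriv ϱ t) t :=
    (hϱC1.differentiable one_ne_zero).differentiableAt.hasDerivAt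
  have hft_eq : ft x t = deriv ϱ t * F x t + ϱ t * f x t
      + (-deriv ϱ t * β * |t| ^ pm + (1 - ϱ t) * β * (pm * |t| ^ (pm - 2) * t)) := by
    rw [hft, funext (hFt x)]
    exact ((hϱd.mul hFd).add
      (((hϱd.const_sub 1).mul_const β).mul (hasDerivAt_abs_rpow t hpm))).deriv
  have key : pm * Ft x t - ft x t * t
      = ϱ t * (pm * F x t - f x t * t) - deriv ϱ t * t * (F x t - β * |t| ^ pm) := by
    have h := Real.abs_rpow_sub_two_mul_mul_self (p := pm) (by positivity) t
    rw [hft_eq, hFt]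
    linear_combination -((1 - ϱ t) * β * pm) * h
  refine ⟨key, ?_⟩
  rw [key]
  rcases eq_or_ne t 0 with rfl | ht
  · simp [hF x 0]
  rcases lt_or_ge |t| (2 * t₂) with hlt | hge
  · have hpos : 0 < ϱ t * (pm * F x t - f x t * t) :=
      mul_pos (hϱ_pos t hlt).1 (hx t (abs_pos.2 ht) (by linarith))
    have hgap : 0 ≤ F x t - β * |t| ^ pm := by
      have h₁ := hlow t (by linarith)
      have h₂ : β * |t| ^ pm ≤ |t| ^ pm :=
        mul_le_of_le_one_left (by positivity) hβ1.le
      linarith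
    have hsign := mul_nonpos_of_nonpos_of_nonneg (hϱ_sign t) hgap
    exact ⟨by linarith, fun h => by linarith, fun h => (h.elim ht hlt.not_ge).elim⟩
  · have hzero : ϱ t = 0 := hϱ_zero t hge
    have hderiv : deriv ϱ t = 0 :=
      IsLocalMin.deriv_eq_zero (Filter.Eventually.of_forall fun s => hzero ▸ hϱ_nonneg s)
    simp [hzero, hderiv, hge]
end

section
/- For all real numbers α, β and every real γ > 1, |α − β|^{γ−2}(α − β)(α₊ − β₊) ≥ |α₊ − β₊|^γ, where α₊ := max{α, 0} and β₊ := max{β, 0} (with the convention that |α−β|^{γ−2}(α−β) = 0 when α = β). -/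
/-- The elementary inequality `|α−β|^{γ−2}(α−β)(α₊−β₊) ≥ |α₊−β₊|^γ` for `γ > 1`,
with the convention that `|α−β|^{γ−2}(α−β) = 0` when `α = β` (automatic for `rpow`,
since `0 ^ (γ-2) * 0 = 0`). Here `α₊ = max α 0`. -/
theorem stmt_18 (α β γ : ℝ) (hγ : 1 < γ) :
    |max α 0 - max β 0| ^ γ ≤ |α - β| ^ (γ - 2) * (α - β) * (max α 0 - max β 0) := by
  have h_le : |max α 0 - max β 0| ≤ |α - β| := abs_max_sub_max_le_abs α β 0
  have h_nonneg : 0 ≤ (α - β) * (max α 0 - max β 0) := by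
    rcases le_total α β with h | h
    · exact mul_nonneg_of_nonpos_of_nonpos (sub_nonpos.2 h)
        (sub_nonpos.2 (max_le_max_right 0 h))
    · exact mul_nonneg (sub_nonneg.2 h) (sub_nonneg.2 (max_le_max_right 0 h))
  have h_abs := abs_of_nonneg h_nonneg
  rw [abs_mul] at h_abs
  rw [mul_assoc, ← h_abs]
  rcases (abs_nonneg (max α 0 - max β 0)).eq_or_lt with h | h
  · rw [← h, Real.zero_rpow (by linarith), mul_zero, mul_zero]
  · calc |max α 0 - max β 0| ^ γ
        = |max α 0 - max β 0| ^ (γ - 1) * |max α 0 - max β 0| := by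
          rw [← Real.rpow_add_one h.ne', sub_add_cancel]
      _ ≤ |α - β| ^ (γ - 1) * |max α 0 - max β 0| := by
          gcongr
      _ = |α - β| ^ (γ - 2) * (|α - β| * |max α 0 - max β 0|) := by
          rw [← mul_assoc, ← Real.rpow_add_one (h.trans_le h_le).ne']
          ring_nf
end
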